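/- arXiv:1708.09775 — 6 statements merged into one kernel-verified Lean document; each statement's English description precedes it below -/
import Mathlib

section
/- Let d ≥ 1 be an integer, 𝕂 = ℝ or ℂ, U ⊆ 𝕂^d an open subset, and E : U → 𝕂 an analytic function. If x∞ ∈ U is a point such that E'(x∞) = 0, then there exist constants C₀ ∈ (0,∞), σ₀ ∈ (0,1] with B_{σ₀}(x∞) ⊆ U, and θ ∈ [1/2, 1) such that ‖E'(x)‖ ≥ C₀ · |E(x) − E(x∞)|^θ for all x ∈ B_{σ₀}(x∞). -/
open Filter Topology Finset

/-! ### Division of analytic functions by a linear form -/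

section Division

variable {𝕜 : Type*} [RCLike 𝕜] {V : Type*} [NormedAddCommGroup V] [NormedSpace 𝕜 V]

/-- The power series of the quotient of `p` by a linear form with kernel the range of `P`, the
complementary direction being `e`. -/
noncomputable def quotientSeries (p : FormalMultilinearSeries 𝕜 V 𝕜) (P : V →L[𝕜] V) (e : V) :
    FormalMultilinearSeries 𝕜 V 𝕜 := fun n =>
  ∑ j : Fin (n + 1), ((p (n + 1)).curryMid j e).compContinuousLinearMap
    (fun i : Fin n => if i.castSucc < j then ContinuousLinearMap.id 𝕜 V else P)

lemma quotientSeries_apply (p : FormalMultilinearSeries 𝕜 V 𝕜) (P : V →L[𝕜] V) (ℓ : V →L[𝕜] 𝕜)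
    (e : V) (hP : ∀ x, x = P x + ℓ x • e) (n : ℕ) (x : V) :
    ℓ x * quotientSeries p P e n (fun _ => x) =
      p (n + 1) (fun _ => x) - p (n + 1) (fun _ => P x) := by
  set v : ℕ → Fin (n + 1) → V := fun j i => if (i : ℕ) < j then x else P x with hv
  have h1 : p (n + 1) (fun _ => x) - p (n + 1) (fun _ => P x) =
      p (n + 1) (v (n + 1)) - p (n + 1) (v 0) := by
    congr 2
    ext i
    simp [hv, i.2]
  rw [h1, ← Finset.sum_range_sub (fun j => p (n + 1) (v j)) (n + 1), quotientSeries,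
    _root_.sum_apply, Finset.mul_sum, Finset.sum_range]
  refine Finset.sum_congr rfl fun j _ => ?_
  have h2 : v (j + 1) = Function.update (v j) j x := by
    ext i
    by_cases hij : i = j
    · subst hij; simp [hv]
    · have : (i : ℕ) ≠ j := fun h => hij (Fin.ext h)
      have h3 : (i : ℕ) < j + 1 ↔ (i : ℕ) < j := by omega
      simp [hv, hij, h3]
  have h3 : v j = Function.update (v j) j (P x) := by
    ext i
    by_cases hij : i = j
    · subst hij; simp [hv]
    · simp [hij]
  have h4 : x = P x + ℓ x • e := hP x
  have h5 : p (n + 1) (v (j + 1)) - p (n + 1) (v j) =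
      ℓ x * p (n + 1) (Function.update (v j) j e) := by
    rw [h2]
    conv_lhs =>
      enter [1, 2, 3]
      rw [h4]
    rw [ContinuousMultilinearMap.map_update_add, ← h3, ContinuousMultilinearMap.map_update_smul]
    simp
  rw [h5]
  congr 1
  rw [ContinuousMultilinearMap.compContinuousLinearMap_apply,
    ContinuousMultilinearMap.curryMid_apply]
  congr 1
  symm
  rw [Fin.eq_insertNth_iff]
  refine ⟨by simp, ?_⟩
  ext i
  simp only [Fin.removeNth, hv]
  rw [Function.update_of_ne (Fin.succAbove_ne _ _)]
  by_cases hij : i.castSucc < j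
  · have : (i : ℕ) < j := hij
    simp only [Fin.succAbove_of_castSucc_lt _ _ hij, hij, Fin.val_castSucc, this, if_true]
    rfl
  · have : ¬ (i : ℕ) + 1 < j := by
      have : ¬ (i : ℕ) < j := hij
      omega
    simp [Fin.succAbove_of_le_castSucc _ _ (not_lt.mp hij), hij, this]

lemma quotientSeries_radius_pos (p : FormalMultilinearSeries 𝕜 V 𝕜) (hp : 0 < p.radius)
    (P : V →L[𝕜] V) (e : V) : 0 < (quotientSeries p P e).radius := by
  obtain ⟨C, r, hC, hr, hb⟩ := p.le_mul_pow_of_radius_pos hp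
  set K : ℝ := max 1 ‖P‖ with hK
  have hK1 : 1 ≤ K := le_max_left _ _
  have hbound : ∀ n, ‖quotientSeries p P e n‖ ≤ C * r * ‖e‖ * (2 * r * K) ^ n := by
    intro n
    have hterm : ∀ j : Fin (n + 1), ‖((p (n + 1)).curryMid j e).compContinuousLinearMap
        (fun i : Fin n => if i.castSucc < j then ContinuousLinearMap.id 𝕜 V else P)‖
        ≤ C * r ^ (n + 1) * ‖e‖ * K ^ n := by
      intro j
      refine (ContinuousMultilinearMap.norm_compContinuousLinearMap_le _ _).trans ?_
      refine mul_le_mul ?_ ?_ (by positivity) (by positivity)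
      · refine (ContinuousLinearMap.le_opNorm _ _).trans ?_
        rw [ContinuousMultilinearMap.norm_curryMid]
        gcongr
        exact hb _
      · calc _ ≤ ∏ i : Fin n, K := by
              refine Finset.prod_le_prod (fun _ _ => norm_nonneg _) fun i _ => ?_
              split_ifs
              · exact ContinuousLinearMap.norm_id_le.trans hK1
              · exact le_max_right _ _
          _ = K ^ n := by simp
    calc _ ≤ ∑ j : Fin (n + 1), C * r ^ (n + 1) * ‖e‖ * K ^ n :=
          (norm_sum_le _ _).trans (Finset.sum_le_sum fun j _ => hterm j)
      _ = (n + 1 : ℝ) * (C * r ^ (n + 1) * ‖e‖ * K ^ n) := by simp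
      _ ≤ (2 : ℝ) ^ n * (C * r ^ (n + 1) * ‖e‖ * K ^ n) := by
          gcongr
          exact_mod_cast Nat.lt_two_pow_self (n := n)
      _ = _ := by rw [mul_pow, mul_pow]; ring
  have hs : 0 < (2 * r * K)⁻¹ := by positivity
  refine lt_of_lt_of_le (b := (((2 * r * K)⁻¹).toNNReal : ENNReal)) (by simpa using hs) ?_
  refine FormalMultilinearSeries.le_radius_of_bound _ (C * r * ‖e‖) fun n => ?_
  rw [Real.coe_toNNReal _ hs.le, inv_pow, ← div_eq_mul_inv, div_le_iff₀ (by positivity)]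
  exact hbound n

/-- An analytic function which vanishes on a hyperplane is divisible by the corresponding
linear form. -/
lemma AnalyticAt.exists_eq_mul_of_vanish {F : V → 𝕜} (hF : AnalyticAt 𝕜 F 0) (P : V →L[𝕜] V)
    (ℓ : V →L[𝕜] 𝕜) (e : V) (hP : ∀ x, x = P x + ℓ x • e) (h0 : ∀ᶠ x in 𝓝 0, F (P x) = 0) :
    ∃ G : V → 𝕜, AnalyticAt 𝕜 G 0 ∧ ∀ᶠ x in 𝓝 0, F x = ℓ x * G x := by
  obtain ⟨p, hp⟩ := hF
  have hq := (quotientSeries p P e).hasFPowerSeriesOnBall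
    (quotientSeries_radius_pos p hp.radius_pos P e)
  refine ⟨(quotientSeries p P e).sum, hq.analyticAt, ?_⟩
  have hPt : Tendsto P (𝓝 0) (𝓝 0) := by simpa using P.continuous.tendsto 0
  have hs := hp.eventually_hasSum
  filter_upwards [h0, hs, hPt.eventually hs, hq.hasFPowerSeriesAt.eventually_hasSum]
    with x hx0 hx hPx hqx
  simp only [zero_add] at hx hPx hqx
  rw [hx0] at hPx
  have h1 := hx.sub hPx
  rw [← hasSum_nat_add_iff' 1] at h1
  have h2 := hqx.mul_left (ℓ x)
  simp only [quotientSeries_apply p P ℓ e hP] at h2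
  have h3 := h1.unique h2
  have h4 : p 0 (fun _ => x) = p 0 (fun _ => P x) := by
    congr 1
    ext i
    exact i.elim0
  simpa [h4] using h3

end Division


/-! ### Monomials and germs of analytic functions -/

section Monomials

variable {𝕜 : Type*} [RCLike 𝕜]

lemma AnalyticAt.eventually_eq_zero_or_of_mul {V : Type*} [NormedAddCommGroup V]
    [NormedSpace 𝕜 V] {F G : V → 𝕜} (hF : AnalyticAt 𝕜 F 0) (hG : AnalyticAt 𝕜 G 0)
    (h : ∀ᶠ x in 𝓝 0, F x * G x = 0) : (∀ᶠ x in 𝓝 0, F x = 0) ∨ ∀ᶠ x in 𝓝 0, G x = 0 := by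
  by_contra! hcon
  obtain ⟨h1, h2⟩ := hcon
  obtain ⟨r, hr, hb⟩ := Metric.eventually_nhds_iff_ball.mp
    (h.and (hF.eventually_analyticAt.and hG.eventually_analyticAt))
  have hsmall : ∀ᶠ x : V in 𝓝 0, ‖x‖ < r / 8 := by
    have := Metric.ball_mem_nhds (0 : V) (show 0 < r / 8 by positivity)
    filter_upwards [this] with x hx using by simpa using hx
  obtain ⟨a, ha, har⟩ := (h1.and_eventually hsmall).exists
  obtain ⟨b, hb0, hbr⟩ := (h2.and_eventually hsmall).exists
  have hline : ∀ t ∈ Metric.ball (0 : 𝕜) 2, a + t • (b - a) ∈ Metric.ball (0 : V) r := by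
    intro t ht
    rw [mem_ball_zero_iff] at ht ⊢
    calc ‖a + t • (b - a)‖ ≤ ‖a‖ + ‖t‖ * (‖b‖ + ‖a‖) := by
          refine (norm_add_le _ _).trans ?_
          rw [norm_smul]
          gcongr
          exact norm_sub_le _ _
      _ ≤ ‖a‖ + 2 * (‖b‖ + ‖a‖) := by gcongr
      _ < r := by linarith
  have hla : ∀ t, AnalyticAt 𝕜 (fun t : 𝕜 => a + t • (b - a)) t := fun t => by fun_prop
  have key := AnalyticOnNhd.eq_zero_or_eq_zero_of_mul_eq_zero
    (f := fun t : 𝕜 => F (a + t • (b - a))) (g := fun t : 𝕜 => G (a + t • (b - a)))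
    (U := Metric.ball (0 : 𝕜) 2)
    (fun t ht => AnalyticAt.fun_comp (f := fun t : 𝕜 => a + t • (b - a)) (hb _ (hline t ht)).2.1 (hla t))
    (fun t ht => AnalyticAt.fun_comp (f := fun t : 𝕜 => a + t • (b - a)) (hb _ (hline t ht)).2.2 (hla t))
    (fun t ht => (hb _ (hline t ht)).1) (convex_ball _ _).isPreconnected
  rcases key with key | key
  · exact ha (by simpa using key 0 (by simp))
  · exact hb0 (by simpa using key 1 (by simp))

variable {σ : Type*} [Fintype σ]

/-- The monomial with exponents `α`. -/
def mono (α : σ → ℕ) (x : σ → 𝕜) : 𝕜 := ∏ i, x i ^ α i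

lemma mono_add (α β : σ → ℕ) (x : σ → 𝕜) :
    mono (α + β) x = mono α x * mono β x := by
  simp [mono, pow_add, Finset.prod_mul_distrib]

lemma mono_zero (x : σ → 𝕜) : mono 0 x = 1 := by simp [mono]

lemma mono_single [DecidableEq σ] (i : σ) (m : ℕ) (x : σ → 𝕜) :
    mono (Pi.single i m) x = x i ^ m := by
  rw [mono, Finset.prod_eq_single i]
  · simp
  · intro j _ hj; simp [hj]
  · simp

lemma mono_smul (m : ℕ) (α : σ → ℕ) (x : σ → 𝕜) : mono (m • α) x = mono α x ^ m := by
  simp [mono, Finset.prod_pow, pow_mul']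

lemma mono_apply_zero {α : σ → ℕ} (hα : α ≠ 0) : mono α (0 : σ → 𝕜) = 0 := by
  obtain ⟨i, hi⟩ := Function.ne_iff.mp hα
  exact Finset.prod_eq_zero (Finset.mem_univ i) (by simpa using hi)

@[fun_prop]
lemma AnalyticAt.mono {V : Type*} [NormedAddCommGroup V] [NormedSpace 𝕜 V] {f : V → σ → 𝕜}
    {x : V} (hf : AnalyticAt 𝕜 f x) (α : σ → ℕ) : AnalyticAt 𝕜 (fun y => _root_.mono α (f y)) x := by
  refine Finset.analyticAt_fun_prod _ fun i _ => ?_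
  have : AnalyticAt 𝕜 (fun y => f y i) x := (analyticAt_pi_iff.mp hf) i
  exact this.pow _

/-- `F` is, near the origin, a monomial times a nonvanishing analytic function. -/
def IsMonomialAt (F : (σ → 𝕜) → 𝕜) : Prop :=
  ∃ (α : σ → ℕ) (u : (σ → 𝕜) → 𝕜), AnalyticAt 𝕜 u 0 ∧ u 0 ≠ 0 ∧
    ∀ᶠ x in 𝓝 0, F x = u x * mono α x

omit [Fintype σ] in
lemma not_eventually_coord_eq_zero (i : σ) : ¬ ∀ᶠ x : σ → 𝕜 in 𝓝 0, x i = 0 := by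
  intro h
  have ht : Tendsto (fun t : 𝕜 => (fun _ : σ => t)) (𝓝[≠] 0) (𝓝 0) :=
    tendsto_nhdsWithin_of_tendsto_nhds (Continuous.tendsto' (by fun_prop) _ _ rfl)
  obtain ⟨t, ht0, ht1⟩ := ((ht.eventually h).and self_mem_nhdsWithin).exists
  exact ht1 ht0

lemma IsMonomialAt.of_mul_eq {F G u : (σ → 𝕜) → 𝕜} {α : σ → ℕ} (hF : AnalyticAt 𝕜 F 0)
    (hG : AnalyticAt 𝕜 G 0) (hu : AnalyticAt 𝕜 u 0) (hu0 : u 0 ≠ 0)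
    (h : ∀ᶠ x in 𝓝 0, F x * G x = u x * mono α x) : IsMonomialAt F := by
  classical
  induction hN : ∑ i, α i generalizing F G α with
  | zero =>
    have hα : α = 0 := by ext i; simpa using Finset.sum_eq_zero_iff.mp hN i (Finset.mem_univ i)
    subst hα
    have h0 := h.self_of_nhds
    rw [mono_zero, mul_one] at h0
    exact ⟨0, F, hF, left_ne_zero_of_mul (h0 ▸ hu0), by simp [mono_zero]⟩
  | succ N ih =>
    obtain ⟨i, hi⟩ : ∃ i, α i ≠ 0 := by
      by_contra! hcon
      simp [hcon] at hN
    obtain ⟨α', rfl⟩ : ∃ α', α = α' + Pi.single i 1 := by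
      refine ⟨α - Pi.single i 1, (tsub_add_cancel_of_le ?_).symm⟩
      intro j
      by_cases hj : j = i
      · subst hj; simpa using Nat.one_le_iff_ne_zero.mpr hi
      · simp [hj]
    have hN' : ∑ i, α' i = N := by
      simpa [Finset.sum_add_distrib] using hN
    set ℓ : (σ → 𝕜) →L[𝕜] 𝕜 := ContinuousLinearMap.proj i with hℓ
    set e : σ → 𝕜 := Pi.single i 1
    set P : (σ → 𝕜) →L[𝕜] (σ → 𝕜) := ContinuousLinearMap.id 𝕜 _ - ℓ.smulRight e with hPdef
    have hP : ∀ x, x = P x + ℓ x • e := by intro x; simp [hPdef]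
    have hPi : ∀ x, P x i = 0 := by intro x; simp [hPdef, e, hℓ]
    have hPt : Tendsto P (𝓝 0) (𝓝 0) := by simpa using P.continuous.tendsto 0
    have hPa : AnalyticAt 𝕜 P 0 := P.analyticAt 0
    have hFP : AnalyticAt 𝕜 (fun x => F (P x)) 0 := AnalyticAt.fun_comp (by simpa using hF) hPa
    have hGP : AnalyticAt 𝕜 (fun x => G (P x)) 0 := AnalyticAt.fun_comp (by simpa using hG) hPa
    have hcancel : ∀ A : (σ → 𝕜) → 𝕜, AnalyticAt 𝕜 A 0 →
        (∀ᶠ x in 𝓝 0, x i * A x = x i * (u x * mono α' x)) →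
        ∀ᶠ x in 𝓝 0, A x = u x * mono α' x := by
      intro A hA hx
      have hm : AnalyticAt 𝕜 (fun x => A x - u x * mono α' x) 0 := by fun_prop
      rcases AnalyticAt.eventually_eq_zero_or_of_mul (F := fun x : σ → 𝕜 => x i)
        (ℓ.analyticAt 0) hm (hx.mono fun x hx => by rw [mul_sub, hx, sub_self]) with h1 | h1
      · exact absurd h1 (not_eventually_coord_eq_zero i)
      · exact h1.mono fun x hx => sub_eq_zero.mp hx
    have hzero : ∀ᶠ x in 𝓝 0, F (P x) * G (P x) = 0 := by
      filter_upwards [hPt.eventually h] with x hx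
      rw [hx, mono_add, mono_single, hPi]
      simp
    rcases AnalyticAt.eventually_eq_zero_or_of_mul hFP hGP hzero with h1 | h1
    · obtain ⟨F', hF', hFF'⟩ := hF.exists_eq_mul_of_vanish P ℓ e hP h1
      have := ih (F := F') (G := G) hF' hG (hcancel (fun x => F' x * G x) (hF'.fun_mul hG) ?_) hN'
      · obtain ⟨β, v, hv, hv0, hF'v⟩ := this
        refine ⟨β + Pi.single i 1, v, hv, hv0, ?_⟩
        filter_upwards [hF'v, hFF'] with x hx1 hx2
        rw [hx2, hx1, mono_add, mono_single, hℓ, ContinuousLinearMap.proj_apply]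
        ring
      · filter_upwards [h, hFF'] with x hx1 hx2
        rw [hx2, mono_add, mono_single, hℓ, ContinuousLinearMap.proj_apply] at hx1
        linear_combination hx1
    · obtain ⟨G', hG', hGG'⟩ := hG.exists_eq_mul_of_vanish P ℓ e hP h1
      refine ih (F := F) (G := G') hF hG' (hcancel (fun x => F x * G' x) (hF.fun_mul hG') ?_) hN'
      filter_upwards [h, hGG'] with x hx1 hx2
      rw [hx2, mono_add, mono_single, hℓ, ContinuousLinearMap.proj_apply] at hx1
      linear_combination hx1

lemma eq_zero_of_pow_mul_eq_pow_mul {A B : 𝕜 → 𝕜} (hA : ContinuousAt A 0)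
    (hB : ContinuousAt B 0) {p q : ℕ} (hpq : p < q) (h : ∀ᶠ t in 𝓝 0, t ^ p * A t = t ^ q * B t) :
    A 0 = 0 := by
  obtain ⟨m, rfl⟩ := Nat.exists_eq_add_of_lt hpq
  have h1 : Tendsto A (𝓝[≠] 0) (𝓝 (A 0)) := hA.tendsto.mono_left nhdsWithin_le_nhds
  have h2 : Tendsto (fun t => t ^ (m + 1) * B t) (𝓝[≠] 0) (𝓝 0) := by
    have : ContinuousAt (fun t => t ^ (m + 1) * B t) 0 := by fun_prop
    simpa using this.tendsto.mono_left nhdsWithin_le_nhds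
  refine tendsto_nhds_unique (h1.congr' ?_) h2
  filter_upwards [nhdsWithin_le_nhds h, self_mem_nhdsWithin] with t ht ht0
  have : t ^ p ≠ 0 := pow_ne_zero _ ht0
  rw [add_assoc, pow_add, mul_assoc] at ht
  exact mul_left_cancel₀ this ht

lemma exists_restrict_mono {u v w : (σ → 𝕜) → 𝕜} (hu : AnalyticAt 𝕜 u 0) (hu0 : u 0 ≠ 0)
    (hv : AnalyticAt 𝕜 v 0) (hv0 : v 0 ≠ 0) (hw : AnalyticAt 𝕜 w 0) {α β γ : σ → ℕ}
    (h : ∀ᶠ x in 𝓝 0, u x * mono α x - v x * mono β x = w x * mono γ x) (S : Finset σ) :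
    ∃ A B C : 𝕜 → 𝕜, ContinuousAt A 0 ∧ ContinuousAt B 0 ∧ ContinuousAt C 0 ∧ A 0 ≠ 0 ∧ B 0 ≠ 0 ∧
      (w 0 ≠ 0 → C 0 ≠ 0) ∧ ∀ᶠ t in 𝓝 0, t ^ (∑ k ∈ S, α k) * A t - t ^ (∑ k ∈ S, β k) * B t =
        t ^ (∑ k ∈ S, γ k) * C t := by
  classical
  have hw0 : ∀ᶠ x in 𝓝 0, w 0 ≠ 0 → w x ≠ 0 := by
    by_cases h0 : w 0 = 0
    · simp [h0]
    · filter_upwards [hw.continuousAt.eventually_ne h0] with x hx _ using hx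
  obtain ⟨r, hr, hb⟩ := Metric.eventually_nhds_iff_ball.mp
    (h.and ((hu.continuousAt.eventually_ne hu0).and ((hv.continuousAt.eventually_ne hv0).and
      (hw0.and (hu.eventually_continuousAt.and
        (hv.eventually_continuousAt.and hw.eventually_continuousAt))))))
  obtain ⟨s, hs0, hsr⟩ := NormedField.exists_norm_lt 𝕜 hr
  rw [norm_pos_iff] at hs0
  set p : 𝕜 → σ → 𝕜 := fun t k => if k ∈ S then t else s with hp
  have hpc : Continuous p := by
    refine continuous_pi fun k => ?_
    by_cases hk : k ∈ S <;> simp only [hp, hk, if_true, if_false] <;> fun_prop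
  have hp0 : p 0 ∈ Metric.ball 0 r := by
    rw [mem_ball_zero_iff, pi_norm_lt_iff hr]
    intro k
    by_cases hk : k ∈ S <;> simp [hp, hk, hr, hsr]
  have hmono : ∀ (δ : σ → ℕ) t, mono δ (p t) = t ^ (∑ k ∈ S, δ k) * s ^ (∑ k ∈ Sᶜ, δ k) := by
    intro δ t
    rw [mono, ← Finset.prod_mul_prod_compl S, ← Finset.prod_pow_eq_pow_sum,
      ← Finset.prod_pow_eq_pow_sum]
    congr 1 <;> refine Finset.prod_congr rfl fun k hk => ?_
    · simp [hp, hk]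
    · simp [hp, Finset.mem_compl.mp hk]
  obtain ⟨-, b2, b3, b4, b5, b6, b7⟩ := hb _ hp0
  refine ⟨fun t => u (p t) * s ^ (∑ k ∈ Sᶜ, α k), fun t => v (p t) * s ^ (∑ k ∈ Sᶜ, β k),
    fun t => w (p t) * s ^ (∑ k ∈ Sᶜ, γ k),
    (ContinuousAt.comp (f := p) b5 hpc.continuousAt).mul continuousAt_const,
    (ContinuousAt.comp (f := p) b6 hpc.continuousAt).mul continuousAt_const,
    (ContinuousAt.comp (f := p) b7 hpc.continuousAt).mul continuousAt_const,
    mul_ne_zero b2 (pow_ne_zero _ hs0), mul_ne_zero b3 (pow_ne_zero _ hs0),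
    fun h0 => mul_ne_zero (b4 h0) (pow_ne_zero _ hs0), ?_⟩
  have : ∀ᶠ t in 𝓝 0, p t ∈ Metric.ball 0 r :=
    hpc.continuousAt.eventually (Metric.isOpen_ball.mem_nhds hp0)
  filter_upwards [this] with t ht
  have := (hb _ ht).1
  rw [hmono, hmono, hmono] at this
  linear_combination this

/-- Two monomials, up to units, whose difference is a monomial up to a unit or vanishes are
comparable for divisibility. -/
lemma le_or_le_of_sub_isMonomialAt {u v : (σ → 𝕜) → 𝕜} (hu : AnalyticAt 𝕜 u 0) (hu0 : u 0 ≠ 0)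
    (hv : AnalyticAt 𝕜 v 0) (hv0 : v 0 ≠ 0) {α β : σ → ℕ}
    (h : (∀ᶠ x in 𝓝 0, u x * mono α x - v x * mono β x = 0) ∨
      IsMonomialAt fun x => u x * mono α x - v x * mono β x) : α ≤ β ∨ β ≤ α := by
  classical
  by_contra! hcon
  obtain ⟨h1, h2⟩ := hcon
  obtain ⟨j, hj⟩ := not_forall.mp h1
  obtain ⟨i, hi⟩ := not_forall.mp h2
  rw [not_le] at hi hj
  have hij : i ≠ j := by rintro rfl; exact lt_asymm hi hj
  rcases h with h | ⟨γ, w, hw, hw0, h⟩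
  · obtain ⟨A, B, C, hA, hB, hC, hA0, hB0, -, hABC⟩ := exists_restrict_mono (α := α) (β := β) (w := 0)
      (γ := β)
      hu hu0 hv hv0 analyticAt_const (h.mono fun x hx => by simp [hx]) {i}
    simp only [Finset.sum_singleton] at hABC
    refine hA0 (eq_zero_of_pow_mul_eq_pow_mul hA (hB.add hC) hi ?_)
    filter_upwards [hABC] with t ht
    simp only [Pi.add_apply]
    linear_combination ht
  · have hγi : γ i = α i := by
      obtain ⟨A, B, C, hA, hB, hC, hA0, hB0, hC0, hABC⟩ := exists_restrict_mono
        hu hu0 hv hv0 hw h {i}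
      simp only [Finset.sum_singleton] at hABC
      obtain ⟨m, hm⟩ := Nat.exists_eq_add_of_lt hi
      rw [hm] at hABC
      by_contra hne
      rcases lt_or_gt_of_ne hne with hlt | hlt
      · refine hC0 hw0 (eq_zero_of_pow_mul_eq_pow_mul (B := fun t => A t - t ^ (m + 1) * B t)
          hC (by fun_prop) hlt ?_)
        filter_upwards [hABC] with t ht
        linear_combination -ht
      · have := eq_zero_of_pow_mul_eq_pow_mul (A := fun t => A t - t ^ (m + 1) * B t) (B := C)
          (by fun_prop) hC hlt ?_
        · exact hA0 (by simpa using this)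
        · filter_upwards [hABC] with t ht
          linear_combination ht
    have hγj : γ j = β j := by
      obtain ⟨A, B, C, hA, hB, hC, hA0, hB0, hC0, hABC⟩ := exists_restrict_mono
        hu hu0 hv hv0 hw h {j}
      simp only [Finset.sum_singleton] at hABC
      obtain ⟨m, hm⟩ := Nat.exists_eq_add_of_lt hj
      rw [hm] at hABC
      by_contra hne
      rcases lt_or_gt_of_ne hne with hlt | hlt
      · refine hC0 hw0 (eq_zero_of_pow_mul_eq_pow_mul (B := fun t => t ^ (m + 1) * A t - B t)
          hC (by fun_prop) hlt ?_)
        filter_upwards [hABC] with t ht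
        linear_combination -ht
      · have := eq_zero_of_pow_mul_eq_pow_mul (A := fun t => t ^ (m + 1) * A t - B t) (B := C)
          (by fun_prop) hC hlt ?_
        · exact hB0 (by simpa using this)
        · filter_upwards [hABC] with t ht
          linear_combination ht
    obtain ⟨A, B, C, hA, hB, hC, hA0, hB0, hC0, hABC⟩ := exists_restrict_mono
      hu hu0 hv hv0 hw h {i, j}
    simp only [Finset.sum_pair hij, hγi, hγj] at hABC
    obtain ⟨m, hm⟩ := Nat.exists_eq_add_of_lt hj
    obtain ⟨m', hm'⟩ := Nat.exists_eq_add_of_lt hi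
    refine hC0 hw0 (eq_zero_of_pow_mul_eq_pow_mul (p := α i + β j)
      (q := α i + β j + 1) (B := fun t => t ^ m * A t - t ^ m' * B t)
      hC (by fun_prop) (Nat.lt_add_one _) ?_)
    filter_upwards [hABC] with t ht
    rw [hm, hm'] at ht
    linear_combination -ht

end Monomials

section Coordinates

variable {𝕜 : Type*} [NontriviallyNormedField 𝕜]
  {V : Type*} [NormedAddCommGroup V] [NormedSpace 𝕜 V]
  {W : Type*} [NormedAddCommGroup W] [NormedSpace 𝕜 W]
  {X : Type*} [NormedAddCommGroup X] [NormedSpace 𝕜 X]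

@[fun_prop]
lemma AnalyticAt.fst_comp {f : X → V × W} {x : X} (hf : AnalyticAt 𝕜 f x) :
    AnalyticAt 𝕜 (fun y => (f y).1) x :=
  analyticAt_fst.fun_comp hf

@[fun_prop]
lemma AnalyticAt.snd_comp {f : X → V × W} {x : X} (hf : AnalyticAt 𝕜 f x) :
    AnalyticAt 𝕜 (fun y => (f y).2) x :=
  analyticAt_snd.fun_comp hf

@[fun_prop]
lemma analyticAt_apply_coord {σ : Type*} [Fintype σ] (i : σ) (x : σ → 𝕜) :
    AnalyticAt 𝕜 (fun y : σ → 𝕜 => y i) x :=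
  (ContinuousLinearMap.proj (R := 𝕜) (φ := fun _ : σ => 𝕜) i).analyticAt x

end Coordinates

/-! ### Derivatives in the last variable -/

section VerticalDeriv

variable {𝕜 : Type*} [RCLike 𝕜] {V : Type*} [NormedAddCommGroup V] [NormedSpace 𝕜 V]

/-- The iterated derivative of `g : V × 𝕜 → 𝕜` in the second variable. -/
noncomputable def vderiv (k : ℕ) (g : V × 𝕜 → 𝕜) (p : V × 𝕜) : 𝕜 :=
  iteratedDeriv k (fun t => g (p.1, t)) p.2

omit [NormedAddCommGroup V] [NormedSpace 𝕜 V] in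
lemma vderiv_zero (g : V × 𝕜 → 𝕜) : vderiv 0 g = g := by
  ext p; simp [vderiv]

omit [NormedAddCommGroup V] [NormedSpace 𝕜 V] in
lemma vderiv_succ (k : ℕ) (g : V × 𝕜 → 𝕜) (p : V × 𝕜) :
    vderiv (k + 1) g p = deriv (fun t => vderiv k g (p.1, t)) p.2 := by
  simp [vderiv, iteratedDeriv_succ]

lemma deriv_vertical {g : V × 𝕜 → 𝕜} {p : V × 𝕜} (hg : AnalyticAt 𝕜 g p) :
    deriv (fun t => g (p.1, t)) p.2 = fderiv 𝕜 g p (0, 1) := by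
  have h1 : HasDerivAt (fun t : 𝕜 => (p.1, t)) ((0 : V), (1 : 𝕜)) p.2 :=
    (hasDerivAt_const _ _).prodMk (hasDerivAt_id _)
  exact (hg.differentiableAt.hasFDerivAt.comp_hasDerivAt (f := fun t : 𝕜 => (p.1, t)) p.2 h1).deriv

lemma analyticAt_vderiv {g : V × 𝕜 → 𝕜} {p : V × 𝕜} (hg : AnalyticAt 𝕜 g p) (k : ℕ) :
    AnalyticAt 𝕜 (vderiv k g) p := by
  induction k with
  | zero => simpa [vderiv_zero] using hg
  | succ k ih =>
    have h : (fun q => fderiv 𝕜 (vderiv k g) q (0, 1)) =ᶠ[𝓝 p] vderiv (k + 1) g := by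
      filter_upwards [ih.eventually_analyticAt] with q hq
      rw [vderiv_succ, deriv_vertical hq]
    refine AnalyticAt.congr ?_ h
    exact (ContinuousLinearMap.apply 𝕜 𝕜 ((0, 1) : V × 𝕜)).analyticAt _ |>.comp
      ih.fderiv

lemma iteratedDeriv_id_mul_zero {h : 𝕜 → 𝕜} (hh : AnalyticAt 𝕜 h 0) (k : ℕ) :
    iteratedDeriv (k + 1) (fun t => t * h t) 0 = (k + 1) * iteratedDeriv k h 0 := by
  have := iteratedDeriv_mul (n := k + 1) (f := fun t : 𝕜 => t) (g := h) (x := 0)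
    contDiffAt_id hh.contDiffAt
  rw [show (fun t => t * h t) = (fun t : 𝕜 => t) * h from rfl, this, Finset.sum_eq_single 1]
  · simp
  · intro b _ hb
    simp [iteratedDeriv_fun_id_zero, hb]
  · simp

lemma vderiv_eq_of_division {g g₁ : V × 𝕜 → 𝕜} (hg₁ : AnalyticAt 𝕜 g₁ 0)
    (h : ∀ᶠ p in 𝓝 0, g p - g (p.1, 0) = p.2 * g₁ p) (k : ℕ) :
    ∀ᶠ y : V in 𝓝 0, vderiv (k + 1) g (y, 0) = (k + 1) * vderiv k g₁ (y, 0) := by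
  have ht : Tendsto (fun y : V => (y, (0 : 𝕜))) (𝓝 0) (𝓝 0) :=
    Continuous.tendsto' (by fun_prop) _ _ rfl
  filter_upwards [ht.eventually h.eventually_nhds, ht.eventually hg₁.eventually_analyticAt]
    with y hy hy₁
  have ht' : Tendsto (fun t : 𝕜 => (y, t)) (𝓝 0) (𝓝 (y, 0)) :=
    Continuous.tendsto' (by fun_prop) _ _ rfl
  have h1 : (fun t => g (y, t)) =ᶠ[𝓝 0] fun t => g (y, 0) + t * g₁ (y, t) := by
    filter_upwards [ht'.eventually hy] with t ht
    rw [← ht]; ring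
  have h2 : AnalyticAt 𝕜 (fun t : 𝕜 => (y, t)) 0 := by fun_prop
  rw [vderiv, vderiv, h1.iteratedDeriv_eq, iteratedDeriv_const_add (Nat.succ_pos _),
    iteratedDeriv_id_mul_zero (AnalyticAt.fun_comp (f := fun t : 𝕜 => (y, t)) hy₁ h2)]

lemma AnalyticAt.exists_vertical_division {g : V × 𝕜 → 𝕜} (hg : AnalyticAt 𝕜 g 0) :
    ∃ g₁ : V × 𝕜 → 𝕜, AnalyticAt 𝕜 g₁ 0 ∧ ∀ᶠ p in 𝓝 0, g p - g (p.1, 0) = p.2 * g₁ p := by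
  have h1 : AnalyticAt 𝕜 (fun p : V × 𝕜 => g (p.1, 0)) 0 :=
    AnalyticAt.fun_comp (f := fun p : V × 𝕜 => (p.1, (0 : 𝕜))) hg (by fun_prop)
  exact (hg.sub h1).exists_eq_mul_of_vanish
    ((ContinuousLinearMap.inl 𝕜 V 𝕜).comp (ContinuousLinearMap.fst 𝕜 V 𝕜))
    (ContinuousLinearMap.snd 𝕜 V 𝕜) (0, 1) (by rintro ⟨a, b⟩; simp) (by simp)

open Nat in
/-- Taylor expansion in the last variable. -/
lemma AnalyticAt.exists_vertical_taylor (n : ℕ) {g : V × 𝕜 → 𝕜} (hg : AnalyticAt 𝕜 g 0) :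
    ∃ u : V × 𝕜 → 𝕜, AnalyticAt 𝕜 u 0 ∧ u 0 = (n ! : 𝕜)⁻¹ * vderiv n g 0 ∧
      ∀ᶠ p in 𝓝 0, g p = p.2 ^ n * u p +
        ∑ i ∈ range n, (i ! : 𝕜)⁻¹ * vderiv i g (p.1, 0) * p.2 ^ i := by
  induction n generalizing g with
  | zero => exact ⟨g, hg, by simp [vderiv_zero], by simp⟩
  | succ n ih =>
    obtain ⟨g₁, hg₁, h⟩ := hg.exists_vertical_division
    obtain ⟨u, hu, hu0, hTay⟩ := ih hg₁
    have key : ∀ k : ℕ, ∀ᶠ y : V in 𝓝 0,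
        (k ! : 𝕜)⁻¹ * vderiv k g₁ (y, 0) =
          ((k + 1) ! : 𝕜)⁻¹ * vderiv (k + 1) g (y, 0) := by
      intro k
      filter_upwards [vderiv_eq_of_division hg₁ h k] with y hy
      rw [hy, Nat.factorial_succ]
      have : (k ! : 𝕜) ≠ 0 := by exact_mod_cast k.factorial_ne_zero
      have : (k + 1 : 𝕜) ≠ 0 := by exact_mod_cast k.succ_ne_zero
      push_cast
      field_simp
    refine ⟨u, hu, hu0.trans (key n).self_of_nhds, ?_⟩
    have hfst : Tendsto (fun p : V × 𝕜 => p.1) (𝓝 0) (𝓝 0) :=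
      Continuous.tendsto' (by fun_prop) _ _ rfl
    have key' := hfst.eventually ((Filter.eventually_all_finset (range n)).mpr fun k _ => key k)
    filter_upwards [h, hTay, key'] with p hp hpT hpk
    rw [Finset.sum_range_succ', vderiv_zero]
    have h2 : ∑ i ∈ range n, ((i + 1) ! : 𝕜)⁻¹ * vderiv (i + 1) g (p.1, 0) * p.2 ^ (i + 1) =
        p.2 * ∑ i ∈ range n, (i ! : 𝕜)⁻¹ * vderiv i g₁ (p.1, 0) * p.2 ^ i := by
      rw [Finset.mul_sum]
      refine Finset.sum_congr rfl fun i hi => ?_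
      rw [hpk i hi]
      ring
    rw [h2, eq_add_of_sub_eq hp, hpT]
    simp
    ring

variable [CompleteSpace V]

lemma AnalyticAt.exists_implicit {f : V × 𝕜 → 𝕜} (hf : AnalyticAt 𝕜 f 0) (h0 : f 0 = 0)
    (h1 : vderiv 1 f 0 ≠ 0) :
    ∃ φ : V → 𝕜, AnalyticAt 𝕜 φ 0 ∧ φ 0 = 0 ∧ ∀ᶠ y in 𝓝 0, f (y, φ y) = 0 := by
  have hc : ContDiffAt 𝕜 ⊤ f (0 : V × 𝕜) := hf.contDiffAt
  have hn : (⊤ : WithTop ℕ∞) ≠ 0 := by simp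
  have hinv : (fderiv 𝕜 f 0 ∘L .inr 𝕜 V 𝕜).IsInvertible := by
    rw [vderiv_succ, vderiv_zero, deriv_vertical hf] at h1
    refine ⟨ContinuousLinearEquiv.unitsEquivAut 𝕜 (Units.mk0 _ h1), ?_⟩
    ext
    simp
  refine ⟨hc.implicitFunction hn hinv, ?_, hc.implicitFunction_apply_self hn hinv, ?_⟩
  · exact (hc.contDiffAt_implicitFunction hn hinv).analyticAt
  · have := hc.eventually_apply_implicitFunction hn hinv
    rwa [h0] at this

/-- Every analytic function of finite positive order in the last variable can be put, by a
translation in that variable, into a normal form without subleading term. -/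
lemma AnalyticAt.exists_normal_form {n : ℕ} {g : V × 𝕜 → 𝕜} (hg : AnalyticAt 𝕜 g 0)
    (h0 : ∀ k < n + 1, vderiv k g 0 = 0) (h1 : vderiv (n + 1) g 0 ≠ 0) :
    ∃ (φ : V → 𝕜) (u : V × 𝕜 → 𝕜) (a : ℕ → V → 𝕜), AnalyticAt 𝕜 φ 0 ∧ φ 0 = 0 ∧
      AnalyticAt 𝕜 u 0 ∧ u 0 ≠ 0 ∧ (∀ i, AnalyticAt 𝕜 (a i) 0) ∧
      ∀ᶠ p in 𝓝 0, g (p.1, p.2 + φ p.1) =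
        p.2 ^ (n + 1) * u p + ∑ i ∈ range n, a i p.1 * p.2 ^ i := by
  obtain ⟨φ, hφ, hφ0, hφv⟩ := (analyticAt_vderiv hg n).exists_implicit (h0 n (Nat.lt_succ_self n))
    (by rw [vderiv_succ, vderiv_zero, ← vderiv_succ]; exact h1)
  set T : V × 𝕜 → V × 𝕜 := fun p => (p.1, p.2 + φ p.1) with hT
  have hT0 : T 0 = 0 := by simp [hT, hφ0]
  have hφ' : AnalyticAt 𝕜 (fun p : V × 𝕜 => φ p.1) 0 :=
    AnalyticAt.fun_comp (f := fun p : V × 𝕜 => p.1) hφ (by fun_prop)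
  have hTa : AnalyticAt 𝕜 T 0 := by fun_prop
  have hgT : AnalyticAt 𝕜 (fun p => g (T p)) 0 := AnalyticAt.fun_comp (by rwa [hT0]) hTa
  have hvT : ∀ k p, vderiv k (fun p => g (T p)) p = vderiv k g (T p) := by
    intro k p
    simp only [vderiv, hT]
    rw [iteratedDeriv_comp_add_const k (fun t => g (p.1, t))]
  obtain ⟨u, hu, hu0, hTay⟩ := hgT.exists_vertical_taylor (n + 1)
  refine ⟨φ, u, fun i y => (i.factorial : 𝕜)⁻¹ * vderiv i (fun p => g (T p)) (y, 0), hφ, hφ0,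
    hu, ?_, fun i => ?_, ?_⟩
  · rw [hu0, hvT, hT0]
    exact mul_ne_zero (inv_ne_zero (by exact_mod_cast (n + 1).factorial_ne_zero)) h1
  · exact analyticAt_const.mul
      (AnalyticAt.fun_comp (f := fun y : V => (y, (0 : 𝕜))) (analyticAt_vderiv hgT i) (by fun_prop))
  · have hfst : Tendsto (fun p : V × 𝕜 => p.1) (𝓝 0) (𝓝 0) :=
      Continuous.tendsto' (by fun_prop) _ _ rfl
    filter_upwards [hTay, hfst.eventually hφv] with p hp hpφ
    rw [hp, Finset.sum_range_succ, hvT n]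
    simp [hT, hpφ]

end VerticalDeriv

/-! ### Lifting along analytic maps -/

section Lifting

variable {𝕜 : Type*} [RCLike 𝕜] {V W X : Type*} [NormedAddCommGroup V] [NormedSpace 𝕜 V]
  [NormedAddCommGroup W] [NormedSpace 𝕜 W] [NormedAddCommGroup X] [NormedSpace 𝕜 X]
  {σ : Type*} [Fintype σ] {ι : Type*}

lemma IsMonomialAt.congr {F G : (σ → 𝕜) → 𝕜} (hF : IsMonomialAt F)
    (h : ∀ᶠ x in 𝓝 0, G x = F x) : IsMonomialAt G := by
  obtain ⟨α, u, hu, hu0, hFu⟩ := hF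
  exact ⟨α, u, hu, hu0, by filter_upwards [h, hFu] with x h1 h2 using h1.trans h2⟩

lemma mono_mul (α : σ → ℕ) (x y : σ → 𝕜) :
    mono α (fun i => x i * y i) = mono α x * mono α y := by
  simp [mono, mul_pow, Finset.prod_mul_distrib]

lemma mono_pow (α : σ → ℕ) (x : σ → 𝕜) (N : ℕ) :
    mono α (fun i => x i ^ N) = mono α x ^ N := by
  simp [mono, ← Finset.prod_pow, ← pow_mul, mul_comm]

lemma mono_ne_zero (α : σ → ℕ) {x : σ → 𝕜} (hx : ∀ i, x i ≠ 0) : mono α x ≠ 0 :=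
  Finset.prod_ne_zero_iff.mpr fun i _ => pow_ne_zero _ (hx i)

variable (𝕜) in
/-- `π` is a germ of analytic map at the origin and `y` is a family tending to the origin which
is mapped by `π` to `x`. -/
def IsLift (l : Filter ι) (π : W → V) (y : ι → W) (x : ι → V) : Prop :=
  AnalyticAt 𝕜 π 0 ∧ π 0 = 0 ∧ Tendsto y l (𝓝 0) ∧ ∀ᶠ i in l, π (y i) = x i

variable {l : Filter ι}

lemma IsLift.tendsto_nhds {π : W → V} {y : ι → W} {x : ι → V} (h : IsLift 𝕜 l π y x) :
    Tendsto π (𝓝 0) (𝓝 0) := by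
  have := h.1.continuousAt.tendsto
  rwa [h.2.1] at this

lemma IsLift.comp {π : W → V} {y : ι → W} {x : ι → V} (h : IsLift 𝕜 l π y x)
    {ρ : X → W} {z : ι → X} (h' : IsLift 𝕜 l ρ z y) : IsLift 𝕜 l (π ∘ ρ) z x := by
  refine ⟨AnalyticAt.comp (by rw [h'.2.1]; exact h.1) h'.1, by simp [h.2.1, h'.2.1], h'.2.2.1, ?_⟩
  filter_upwards [h.2.2.2, h'.2.2.2] with i h1 h2
  simp [h1, h2]

lemma IsLift.analyticAt_comp {π : W → V} {y : ι → W} {x : ι → V} (h : IsLift 𝕜 l π y x)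
    {Y : Type*} [NormedAddCommGroup Y] [NormedSpace 𝕜 Y]
    {F : V → Y} (hF : AnalyticAt 𝕜 F 0) : AnalyticAt 𝕜 (fun w => F (π w)) 0 :=
  AnalyticAt.fun_comp (by rw [h.2.1]; exact hF) h.1

lemma IsLift.prodMap_id {π : W → V} {y : ι → W} {x : ι → V × 𝕜}
    (h : IsLift 𝕜 l π y (fun i => (x i).1)) (hx : Tendsto x l (𝓝 0)) :
    IsLift 𝕜 l (fun p : W × 𝕜 => (π p.1, p.2)) (fun i => (y i, (x i).2)) x := by
  refine ⟨?_, by simp [h.2.1], ?_, ?_⟩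
  · have : AnalyticAt 𝕜 (fun p : W × 𝕜 => π p.1) 0 :=
      AnalyticAt.fun_comp (f := fun p : W × 𝕜 => p.1) h.1 (by fun_prop)
    exact this.prod analyticAt_snd
  · exact h.2.2.1.prodMk_nhds ((Continuous.tendsto' continuous_snd (0 : V × 𝕜) 0 rfl).comp hx)
  · filter_upwards [h.2.2.2] with i hi
    rw [hi]

variable (𝕜 l) in
/-- The function `F` becomes a monomial times a nonvanishing function after pulling back along a
map through which the family `x` factors. -/
def MonAlong (σ : Type*) [Fintype σ] (F : V → 𝕜) (x : ι → V) : Prop :=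
  ∃ (π : (σ → 𝕜) → V) (y : ι → σ → 𝕜), IsLift 𝕜 l π y x ∧ IsMonomialAt fun w => F (π w)

lemma MonAlong.of_lift {π : W → V} {y : ι → W} {x : ι → V} (h : IsLift 𝕜 l π y x) {F : V → 𝕜}
    (hF : MonAlong 𝕜 l σ (fun w => F (π w)) y) : MonAlong 𝕜 l σ F x := by
  obtain ⟨ρ, z, hρ, hm⟩ := hF
  exact ⟨π ∘ ρ, z, h.comp hρ, hm⟩

lemma MonAlong.congr {F G : V → 𝕜} {x : ι → V} (hF : MonAlong 𝕜 l σ F x)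
    (h : ∀ᶠ p in 𝓝 0, G p = F p) : MonAlong 𝕜 l σ G x := by
  obtain ⟨ρ, z, hρ, hm⟩ := hF
  exact ⟨ρ, z, hρ, hm.congr (hρ.tendsto_nhds.eventually h)⟩

lemma MonAlong.unit_mul {F v : V → 𝕜} {x : ι → V} (hF : MonAlong 𝕜 l σ F x)
    (hv : AnalyticAt 𝕜 v 0) (hv0 : v 0 ≠ 0) : MonAlong 𝕜 l σ (fun p => v p * F p) x := by
  obtain ⟨ρ, z, hρ, α, u, hu, hu0, hm⟩ := hF
  refine ⟨ρ, z, hρ, α, fun w => v (ρ w) * u w, (hρ.analyticAt_comp hv).mul hu, ?_, ?_⟩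
  · simpa [hρ.2.1] using ⟨hv0, hu0⟩
  · filter_upwards [hm] with w hw
    rw [hw, mul_assoc]

lemma MonAlong.of_prod {e : ℕ} {x : ι → (Fin e → 𝕜) × 𝕜} (hx : Tendsto x l (𝓝 0))
    {F u : (Fin e → 𝕜) × 𝕜 → 𝕜} {α : Fin e → ℕ} {m : ℕ} (hu : AnalyticAt 𝕜 u 0) (hu0 : u 0 ≠ 0)
    (h : ∀ᶠ p in 𝓝 0, F p = u p * (mono α p.1 * p.2 ^ m)) :
    MonAlong 𝕜 l (Fin (e + 1)) F x := by
  have hl : IsLift 𝕜 l (fun q : Fin (e + 1) → 𝕜 => ((fun i => q i.succ : Fin e → 𝕜), q 0))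
      (fun i => Fin.cons (x i).2 (x i).1) x := by
    refine ⟨?_, rfl, ?_, by simp⟩
    · have : AnalyticAt 𝕜 (fun q : Fin (e + 1) → 𝕜 => (fun i => q i.succ : Fin e → 𝕜)) 0 :=
        analyticAt_pi_iff.mpr fun i => by fun_prop
      exact this.prod (by fun_prop)
    · rw [tendsto_pi_nhds]
      intro j
      have h1 := (Continuous.tendsto' continuous_fst (0 : (Fin e → 𝕜) × 𝕜) 0 rfl).comp hx
      refine Fin.cases ?_ (fun j => ?_) j
      · simpa [Function.comp_def] using
          (Continuous.tendsto' continuous_snd (0 : (Fin e → 𝕜) × 𝕜) 0 rfl).comp hx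
      · simpa using tendsto_pi_nhds.mp h1 j
  refine ⟨_, _, hl, Fin.cons m α, _, hl.analyticAt_comp hu, hu0, ?_⟩
  filter_upwards [hl.tendsto_nhds.eventually h] with q hq
  rw [hq]
  simp [mono, Fin.prod_univ_succ]
  ring_nf
  simp

/-- Families in `𝕜` tending to zero along an ultrafilter have roots, up to a constant factor. -/
lemma exists_root_along (l : Ultrafilter ι) {y : ι → 𝕜} (hy : Tendsto y l (𝓝 0)) {N : ℕ}
    (hN : N ≠ 0) :
    ∃ (c : 𝕜) (w : ι → 𝕜), c ≠ 0 ∧ Tendsto w l (𝓝 0) ∧ ∀ᶠ i in l, c * w i ^ N = y i := by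
  by_cases h0 : ∀ᶠ i in l, y i = 0
  · exact ⟨1, fun _ => 0, one_ne_zero, tendsto_const_nhds, by
      filter_upwards [h0] with i hi; simp [hi, hN]⟩
  have h0' : ∀ᶠ i in l, y i ≠ 0 := Ultrafilter.eventually_not.mpr h0
  set s : ι → 𝕜 := fun i => (‖y i‖ : 𝕜)⁻¹ * y i with hs
  have hs1 : ∀ᶠ i in l, s i ∈ Metric.sphere (0 : 𝕜) 1 := by
    filter_upwards [h0'] with i hi
    have : ‖y i‖ ≠ 0 := norm_ne_zero_iff.mpr hi
    simp [hs, this]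
  obtain ⟨c, hc, hcl⟩ := (isCompact_sphere (0 : 𝕜) 1).ultrafilter_le_nhds (l.map s)
    (by rw [Filter.le_principal_iff]; exact hs1)
  have hc0 : c ≠ 0 := by rintro rfl; simp at hc
  have hsc : Tendsto (fun i => c⁻¹ * s i) l (𝓝 1) := by
    have : Tendsto s l (𝓝 c) := hcl
    simpa [hc0] using this.const_mul c⁻¹
  have hmap : map (fun t : 𝕜 => t ^ N) (𝓝 1) = 𝓝 1 := by
    have := (hasStrictDerivAt_pow N (1 : 𝕜)).map_nhds_eq (by simpa using hN)
    simpa using this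
  have hev : ∀ᶠ i in l, ∃ r : 𝕜, ‖r‖ ≤ 2 ∧ r ^ N = c⁻¹ * s i := by
    refine hsc.eventually (p := fun t => ∃ r : 𝕜, ‖r‖ ≤ 2 ∧ r ^ N = t) ?_
    rw [← hmap, eventually_map]
    have : ∀ᶠ t : 𝕜 in 𝓝 1, ‖t‖ < 2 :=
      continuous_norm.continuousAt.eventually (Iio_mem_nhds (by simp))
    filter_upwards [this] with t ht using ⟨t, ht.le, rfl⟩
  have hch : ∀ i, ∃ r : 𝕜, ‖r‖ ≤ 2 ∧ ((∃ r : 𝕜, ‖r‖ ≤ 2 ∧ r ^ N = c⁻¹ * s i) →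
      r ^ N = c⁻¹ * s i) := by
    intro i
    by_cases h : ∃ r : 𝕜, ‖r‖ ≤ 2 ∧ r ^ N = c⁻¹ * s i
    · obtain ⟨r, h1, h2⟩ := h
      exact ⟨r, h1, fun _ => h2⟩
    · exact ⟨0, by simp, fun h' => absurd h' h⟩
  choose r hr2 hr using hch
  refine ⟨c, fun i => ((‖y i‖ ^ (N : ℝ)⁻¹ : ℝ) : 𝕜) * r i, hc0, ?_, ?_⟩
  · have hp : Tendsto (fun i => ‖y i‖ ^ (N : ℝ)⁻¹) l (𝓝 0) := by
      have h1 := hy.norm.rpow_const (p := (N : ℝ)⁻¹) (Or.inr (by positivity))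
      have h2 : (N : ℝ)⁻¹ ≠ 0 := by simpa using hN
      simpa [Real.zero_rpow h2] using h1
    refine squeeze_zero_norm (a := fun i => ‖y i‖ ^ (N : ℝ)⁻¹ * 2) (fun i => ?_) (by
      simpa using hp.mul_const 2)
    rw [norm_mul, RCLike.norm_ofReal, abs_of_nonneg (by positivity)]
    gcongr
    exact hr2 i
  · filter_upwards [hev, h0'] with i hi hyi
    have h1 : (‖y i‖ : 𝕜) ≠ 0 := by simpa using hyi
    rw [mul_pow, hr i hi, ← RCLike.ofReal_pow, Real.rpow_inv_natCast_pow (norm_nonneg _) hN, hs]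
    field_simp

lemma exists_pow_lift {σ : Type*} [Fintype σ] (l : Ultrafilter ι) {y : ι → σ → 𝕜}
    (hy : Tendsto y l (𝓝 0)) {N : ℕ} (hN : N ≠ 0) :
    ∃ (c : σ → 𝕜) (w : ι → σ → 𝕜), (∀ k, c k ≠ 0) ∧
      IsLift 𝕜 l (fun (w : σ → 𝕜) k => c k * w k ^ N) w y := by
  choose c w hc hw h using fun k => exists_root_along l (tendsto_pi_nhds.mp hy k) hN
  refine ⟨c, fun i k => w k i, hc, ?_, ?_, tendsto_pi_nhds.mpr hw, ?_⟩
  · exact analyticAt_pi_iff.mpr fun i => by fun_prop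
  · ext; simp [hN]
  · filter_upwards [Filter.eventually_all.mpr h] with i hi
    ext k
    exact hi k

lemma IsMonomialAt.comp_pow {F : (σ → 𝕜) → 𝕜} (hF : IsMonomialAt F) {N : ℕ} (hN : N ≠ 0)
    {c : σ → 𝕜} (hc : ∀ k, c k ≠ 0) : IsMonomialAt fun w => F (fun k => c k * w k ^ N) := by
  obtain ⟨α, u, hu, hu0, h⟩ := hF
  have hρ : AnalyticAt 𝕜 (fun (w : σ → 𝕜) k => c k * w k ^ N) 0 :=
    analyticAt_pi_iff.mpr fun i => by fun_prop
  have hρ0 : (fun k => c k * (0 : σ → 𝕜) k ^ N) = 0 := by ext; simp [hN]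
  have ht := hρ.continuousAt.tendsto
  rw [hρ0] at ht
  refine ⟨N • α, fun w => u (fun k => c k * w k ^ N) * mono α c, ?_, ?_, ?_⟩
  · exact (AnalyticAt.fun_comp (f := fun (w : σ → 𝕜) k => c k * w k ^ N)
      (by rwa [hρ0]) hρ).mul analyticAt_const
  · simp only [hρ0]; exact mul_ne_zero hu0 (mono_ne_zero α hc)
  · filter_upwards [ht.eventually h] with w hw
    rw [hw, mono_mul α c (fun k => w k ^ N), mono_pow, mono_smul]
    ring

end Lifting

/-! ### Monomialization of finite families -/

section Families

variable {𝕜 : Type*} [RCLike 𝕜] {ι : Type*}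

variable (𝕜) in
/-- Every nonzero germ of analytic function in `e` variables can be made monomial along every
family converging to the origin. -/
def Monomializable (l : Filter ι) (e : ℕ) : Prop :=
  ∀ (F : (Fin e → 𝕜) → 𝕜) (x : ι → Fin e → 𝕜), AnalyticAt 𝕜 F 0 →
    (¬ ∀ᶠ p in 𝓝 0, F p = 0) → Tendsto x l (𝓝 0) → MonAlong 𝕜 l (Fin e) F x

lemma not_eventually_prod_eq_zero {V : Type*} [NormedAddCommGroup V] [NormedSpace 𝕜 V] {J : Type*}
    (s : Finset J) {f : J → V → 𝕜} (hf : ∀ j ∈ s, AnalyticAt 𝕜 (f j) 0)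
    (h0 : ∀ j ∈ s, ¬ ∀ᶠ p in 𝓝 0, f j p = 0) : ¬ ∀ᶠ p in 𝓝 0, ∏ j ∈ s, f j p = 0 := by
  classical
  induction s using Finset.induction_on with
  | empty => simpa using NeBot.ne inferInstance
  | insert a s ha ih =>
    intro h
    simp only [Finset.prod_insert ha] at h
    rcases (hf a (by simp)).eventually_eq_zero_or_of_mul
      (Finset.analyticAt_fun_prod s fun j hj => hf j (by simp [hj])) h with h | h
    · exact h0 a (by simp) h
    · exact ih (fun j hj => hf j (by simp [hj])) (fun j hj => h0 j (by simp [hj])) h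

lemma Monomializable.family {l : Filter ι} {e : ℕ} (hM : Monomializable 𝕜 l e) {J : Type*}
    [Fintype J] {f : J → (Fin e → 𝕜) → 𝕜} (hf : ∀ j, AnalyticAt 𝕜 (f j) 0)
    {x : ι → Fin e → 𝕜} (hx : Tendsto x l (𝓝 0)) :
    ∃ (π : (Fin e → 𝕜) → Fin e → 𝕜) (y : ι → Fin e → 𝕜), IsLift 𝕜 l π y x ∧
      ∀ j, ((∀ᶠ p in 𝓝 0, f j p = 0) ∧ ∀ᶠ w in 𝓝 0, f j (π w) = 0) ∨
        IsMonomialAt fun w => f j (π w) := by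
  classical
  set s : Finset J := Finset.univ.filter fun j => ¬ ∀ᶠ p in 𝓝 0, f j p = 0 with hs
  obtain ⟨π, y, hπ, α, u, hu, hu0, h⟩ := hM (fun p => ∏ j ∈ s, f j p) x
    (Finset.analyticAt_fun_prod s fun j _ => hf j)
    (not_eventually_prod_eq_zero s (fun j _ => hf j) (by simp [hs])) hx
  refine ⟨π, y, hπ, fun j => ?_⟩
  by_cases hj : ∀ᶠ p in 𝓝 0, f j p = 0
  · exact Or.inl ⟨hj, hπ.tendsto_nhds.eventually hj⟩
  · right
    have hjs : j ∈ s := Finset.mem_filter.mpr ⟨Finset.mem_univ j, hj⟩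
    refine IsMonomialAt.of_mul_eq (G := fun w => ∏ i ∈ s.erase j, f i (π w))
      (hπ.analyticAt_comp (hf j)) (Finset.analyticAt_fun_prod _ fun i _ =>
        hπ.analyticAt_comp (hf i)) hu hu0 (α := α) ?_
    filter_upwards [h] with w hw
    rw [← hw, Finset.mul_prod_erase s (fun i => f i (π w)) hjs]

lemma exists_forall_le_of_total {J σ : Type*} [Fintype σ] {S : Finset J} (hS : S.Nonempty)
    {β : J → σ → ℕ} (h : ∀ i ∈ S, ∀ j ∈ S, β i ≤ β j ∨ β j ≤ β i) :
    ∃ i ∈ S, ∀ j ∈ S, β i ≤ β j := by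
  obtain ⟨i, hi, hmin⟩ := S.exists_min_image (fun j => ∑ k, β j k) hS
  refine ⟨i, hi, fun j hj => ?_⟩
  rcases h i hi j hj with h | h
  · exact h
  · have h1 := (Finset.sum_eq_sum_iff_of_le fun k _ => h k).mp
      (le_antisymm (Finset.sum_le_sum fun k _ => h k) (hmin j hj))
    exact fun k => (h1 k (Finset.mem_univ k)).ge

/-- A simultaneous lift which makes `h` monomial, and the coefficients `a i` divisible by the
appropriate powers of one and the same monomial, one of the quotients being a unit. -/
lemma Monomializable.exists_comparable {l : Ultrafilter ι} {e : ℕ}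
    (hM : Monomializable 𝕜 (l : Filter ι) e) (n : ℕ) {h : (Fin e → 𝕜) → 𝕜}
    (hh : AnalyticAt 𝕜 h 0) (hh0 : ¬ ∀ᶠ p in 𝓝 0, h p = 0) {a : ℕ → (Fin e → 𝕜) → 𝕜}
    (ha : ∀ i, AnalyticAt 𝕜 (a i) 0) {x : ι → Fin e → 𝕜} (hx : Tendsto x l (𝓝 0)) :
    ∃ (π : (Fin e → 𝕜) → Fin e → 𝕜) (y : ι → Fin e → 𝕜), IsLift 𝕜 l π y x ∧
      IsMonomialAt (fun w => h (π w)) ∧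
      ((∀ i < n, ∀ᶠ w in 𝓝 0, a i (π w) = 0) ∨
        ∃ (γ : Fin e → ℕ) (b : ℕ → (Fin e → 𝕜) → 𝕜), (∀ i, AnalyticAt 𝕜 (b i) 0) ∧
          (∃ i < n, b i 0 ≠ 0) ∧
          ∀ i < n, ∀ᶠ w in 𝓝 0, a i (π w) = mono γ w ^ (n + 1 - i) * b i w) := by
  classical
  set N : ℕ := (n + 1).factorial with hN
  have hN0 : N ≠ 0 := (n + 1).factorial_ne_zero
  set d : ℕ → ℕ := fun i => N / (n + 1 - i) with hd
  have hdN : ∀ i < n, (n + 1 - i) * d i = N := fun i hi =>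
    Nat.mul_div_cancel' (Nat.dvd_factorial (by omega) (by omega))
  have hd0 : ∀ i < n, d i ≠ 0 := fun i hi h0 => hN0 (by rw [← hdN i hi, h0, mul_zero])
  set f : Option (Fin n ⊕ Fin n × Fin n) → (Fin e → 𝕜) → 𝕜 := fun j => match j with
    | none => h
    | some (.inl i) => a i
    | some (.inr (i, j)) => fun p => a i p ^ d i - a j p ^ d j with hf
  have hfa : ∀ j, AnalyticAt 𝕜 (f j) 0 := by
    rintro (_ | i | ⟨i, j⟩)
    · exact hh
    · exact ha i
    · exact ((ha i).fun_pow _).fun_sub ((ha j).fun_pow _)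
  obtain ⟨π, y, hπ, hfam⟩ := hM.family hfa hx
  have hhm : IsMonomialAt fun w => h (π w) := by
    rcases hfam none with hz | hm
    · exact absurd hz.1 hh0
    · exact hm
  obtain ⟨c, w, hc, hw⟩ := exists_pow_lift l hπ.2.2.1 hN0
  set ρ : (Fin e → 𝕜) → Fin e → 𝕜 := fun w k => c k * w k ^ N with hρ
  refine ⟨π ∘ ρ, w, hπ.comp hw, hhm.comp_pow hN0 hc, ?_⟩
  set S : Finset (Fin n) := Finset.univ.filter fun i => ¬ ∀ᶠ w in 𝓝 0, a i (π w) = 0 with hS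
  rcases S.eq_empty_or_nonempty with hSe | hSne
  · left
    intro i hi
    have : ∀ᶠ w in 𝓝 0, a i (π w) = 0 := by
      by_contra hcon
      have : (⟨i, hi⟩ : Fin n) ∈ S := Finset.mem_filter.mpr ⟨Finset.mem_univ _, hcon⟩
      simp [hSe] at this
    exact hw.tendsto_nhds.eventually this
  · right
    have hmon : ∀ i : Fin n, ∃ (α : Fin e → ℕ) (u : (Fin e → 𝕜) → 𝕜), AnalyticAt 𝕜 u 0 ∧
        (i ∈ S → u 0 ≠ 0) ∧ (∀ᶠ w in 𝓝 0, a i (π w) = u w * mono α w) ∧ (i ∉ S → ∀ w, u w = 0) := by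
      intro i
      by_cases hi : i ∈ S
      · rcases hfam (some (.inl i)) with hz | ⟨α, u, hu, hu0, hm⟩
        · exact absurd hz.2 (Finset.mem_filter.mp hi).2
        · exact ⟨α, u, hu, fun _ => hu0, hm, fun h => absurd hi h⟩
      · refine ⟨0, fun _ => 0, analyticAt_const, fun h => absurd h hi, ?_, fun _ _ => rfl⟩
        have : ∀ᶠ w in 𝓝 0, a i (π w) = 0 := by simpa [hS] using hi
        simpa using this
    choose α u hu hu0 hm huz using hmon
    obtain ⟨i₀, hi₀, hmin⟩ := exists_forall_le_of_total hSne (β := fun i => d i • α i) (by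
      intro i hi j hj
      have hpow : ∀ i : Fin n, ∀ᶠ w in 𝓝 0, a i (π w) ^ d i = u i w ^ d i * mono (d i • α i) w := by
        intro i
        filter_upwards [hm i] with w hw
        rw [hw, mul_pow, mono_smul]
      refine le_or_le_of_sub_isMonomialAt ((hu i).fun_pow (d i)) (pow_ne_zero _ (hu0 i hi))
        ((hu j).fun_pow (d j)) (pow_ne_zero _ (hu0 j hj)) ?_
      rcases hfam (some (.inr (i, j))) with hz | hz
      · left
        filter_upwards [hz.2, hpow i, hpow j] with w h1 h2 h3
        rw [← h2, ← h3]
        exact h1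
      · right
        refine hz.congr ?_
        filter_upwards [hpow i, hpow j] with w h2 h3
        rw [← h2, ← h3])
    set γ := d i₀ • α i₀ with hγ
    refine ⟨γ, fun i w => if hi : i < n then u ⟨i, hi⟩ (ρ w) * mono (α ⟨i, hi⟩) c *
      mono (d i • α ⟨i, hi⟩ - γ) w ^ (n + 1 - i) else 0, ?_, ⟨i₀, i₀.2, ?_⟩, ?_⟩
    · intro i
      by_cases hi : i < n
      · simp only [hi, dif_pos]
        have := hw.analyticAt_comp (hu ⟨i, hi⟩)
        have h2 : AnalyticAt 𝕜 (fun w : Fin e → 𝕜 => mono (d i • α ⟨i, hi⟩ - γ) w) 0 := by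
          fun_prop
        exact (this.mul analyticAt_const).mul (h2.fun_pow _)
      · simp only [hi, dif_neg, not_false_eq_true]
        exact analyticAt_const
    · have : d i₀ • α i₀ - γ = 0 := by rw [hγ, tsub_self]
      simp only [i₀.2, dif_pos, Fin.eta, this, mono_zero, one_pow, mul_one, hw.2.1]
      exact mul_ne_zero (hu0 i₀ hi₀) (mono_ne_zero _ hc)
    · intro i hi
      filter_upwards [hw.tendsto_nhds.eventually (hm ⟨i, hi⟩)] with w hww
      simp only [hi, dif_pos, Function.comp_apply]
      rw [hww]
      by_cases hiS : (⟨i, hi⟩ : Fin n) ∈ S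
      · have h1 : γ + (d i • α ⟨i, hi⟩ - γ) = d i • α ⟨i, hi⟩ :=
          add_tsub_cancel_of_le (hmin _ hiS)
        have h2 : mono (α ⟨i, hi⟩) w ^ N =
            mono γ w ^ (n + 1 - i) * mono (d i • α ⟨i, hi⟩ - γ) w ^ (n + 1 - i) := by
          rw [← mul_pow, ← mono_add, h1, mono_smul, ← pow_mul, mul_comm (d i), hdN i hi]
        rw [hρ, mono_mul _ c (fun k => w k ^ N), mono_pow, h2]
        ring
      · rw [huz _ hiS]
        simp

end Families

/-! ### Reduction of the order in the last variable -/

section Reduction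

variable {𝕜 : Type*} [RCLike 𝕜] {ι : Type*}

lemma iteratedDeriv_polynomial_eval_zero (P : Polynomial 𝕜) (k : ℕ) :
    iteratedDeriv k (fun t => P.eval t) 0 = k.factorial * P.coeff k := by
  have h : ∀ (k : ℕ) (P : Polynomial 𝕜), iteratedDeriv k (fun t => P.eval t) =
      fun t => (Polynomial.derivative^[k] P).eval t := by
    intro k
    induction k with
    | zero => intro P; simp
    | succ k ih =>
      intro P
      rw [iteratedDeriv_succ', Function.iterate_succ_apply, ← ih]
      congr 1
      ext t
      simp
  rw [h]
  beta_reduce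
  rw [← Polynomial.coeff_zero_eq_eval_zero, Polynomial.coeff_iterate_derivative]
  simp [Nat.descFactorial_self]

lemma iteratedDeriv_ne_zero_of_coeff {f v : 𝕜 → 𝕜} (hv : AnalyticAt 𝕜 v 0) {P : Polynomial 𝕜}
    {m k : ℕ} (hk : k < m) (hP : P.coeff k ≠ 0)
    (h : ∀ᶠ t in 𝓝 0, f t = t ^ m * v t + P.eval t) : iteratedDeriv k f 0 ≠ 0 := by
  have ha : AnalyticAt 𝕜 (fun t => t ^ m * v t) 0 := by fun_prop
  have hP' : AnalyticAt 𝕜 (fun t => P.eval t) 0 := by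
    simpa using AnalyticAt.aeval_polynomial (analyticAt_id (𝕜 := 𝕜) (z := (0 : 𝕜))) P
  have h1 : iteratedDeriv k (fun t => t ^ m * v t) 0 = 0 := by
    refine (natCast_le_analyticOrderAt_iff_iteratedDeriv_eq_zero (n := m) ha).mp ?_ k hk
    rw [natCast_le_analyticOrderAt ha]
    exact ⟨v, hv, by simp⟩
  have h2 : f =ᶠ[𝓝 0] (fun t => t ^ m * v t) + fun t => P.eval t := h
  rw [h2.iteratedDeriv_eq, iteratedDeriv_add ha.contDiffAt hP'.contDiffAt, h1, zero_add,
    iteratedDeriv_polynomial_eval_zero]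
  exact mul_ne_zero (by exact_mod_cast k.factorial_ne_zero) hP

lemma not_eventually_mono_eq_zero {σ : Type*} [Fintype σ] (α : σ → ℕ) :
    ¬ ∀ᶠ x : σ → 𝕜 in 𝓝 0, mono α x = 0 := by
  intro h
  have ht : Tendsto (fun t : 𝕜 => (fun _ : σ => t)) (𝓝[≠] 0) (𝓝 0) :=
    tendsto_nhdsWithin_of_tendsto_nhds (Continuous.tendsto' (by fun_prop) _ _ rfl)
  obtain ⟨t, ht0, ht1⟩ := ((ht.eventually h).and self_mem_nhdsWithin).exists
  exact mono_ne_zero α (fun _ => ht1) ht0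

variable (𝕜) in
/-- Products of a function of the first `e` variables and of a function of order less than `n` in
the last variable can be made monomial along every family converging to the origin. -/
def MonomializableOfOrder (l : Filter ι) (e n : ℕ) : Prop :=
  ∀ (h : (Fin e → 𝕜) → 𝕜) (g : (Fin e → 𝕜) × 𝕜 → 𝕜) (x : ι → (Fin e → 𝕜) × 𝕜),
    AnalyticAt 𝕜 h 0 → (¬ ∀ᶠ p in 𝓝 0, h p = 0) → AnalyticAt 𝕜 g 0 →
    (∃ k < n, vderiv k g 0 ≠ 0) → Tendsto x l (𝓝 0) →
    MonAlong 𝕜 l (Fin (e + 1)) (fun p => h p.1 * g p) x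

variable {e : ℕ}

/-- The blow-up in the chart where the parameter `w k` divides the last variable. -/
lemma isLift_blowup_param {l : Filter ι} {x : ι → (Fin e → 𝕜) × 𝕜} (hx : Tendsto x l (𝓝 0))
    {k : Fin e} {q : ι → 𝕜} {c : 𝕜} (hq : Tendsto q l (𝓝 c))
    (h : ∀ᶠ i in l, (x i).1 k * q i = (x i).2) :
    IsLift 𝕜 l (fun p : (Fin e → 𝕜) × 𝕜 => (p.1, p.1 k * (p.2 + c)))
      (fun i => ((x i).1, q i - c)) x := by
  have h1 := (Continuous.tendsto' continuous_fst (0 : (Fin e → 𝕜) × 𝕜) 0 rfl).comp hx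
  refine ⟨?_, by simp, ?_, ?_⟩
  · have : AnalyticAt 𝕜 (fun p : (Fin e → 𝕜) × 𝕜 => p.1 k) 0 :=
      AnalyticAt.fun_comp (f := fun p : (Fin e → 𝕜) × 𝕜 => p.1) (g := fun w => w k)
        (by fun_prop) (by fun_prop)
    fun_prop
  · exact h1.prodMk_nhds (by simpa using hq.sub_const c)
  · filter_upwards [h] with i hi
    simp [hi]

/-- The blow-up in the chart where the last variable divides the parameter `w k`. -/
lemma isLift_blowup_last {l : Filter ι} {x : ι → (Fin e → 𝕜) × 𝕜} (hx : Tendsto x l (𝓝 0))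
    {k : Fin e} {r : ι → 𝕜} (hr : Tendsto r l (𝓝 0))
    (h : ∀ᶠ i in l, (x i).2 * r i = (x i).1 k) :
    IsLift 𝕜 l (fun p : (Fin e → 𝕜) × 𝕜 => (fun j => (if j = k then p.2 else 1) * p.1 j, p.2))
      (fun i => (Function.update (x i).1 k (r i), (x i).2)) x := by
  have h1 := (Continuous.tendsto' continuous_fst (0 : (Fin e → 𝕜) × 𝕜) 0 rfl).comp hx
  have h2 := (Continuous.tendsto' continuous_snd (0 : (Fin e → 𝕜) × 𝕜) 0 rfl).comp hx
  refine ⟨?_, ?_, ?_, ?_⟩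
  · have : AnalyticAt 𝕜
        (fun p : (Fin e → 𝕜) × 𝕜 => (fun j => (if j = k then p.2 else 1) * p.1 j)) 0 := by
      refine analyticAt_pi_iff.mpr fun j => ?_
      have h3 : AnalyticAt 𝕜 (fun p : (Fin e → 𝕜) × 𝕜 => p.1 j) 0 :=
        AnalyticAt.fun_comp (f := fun p : (Fin e → 𝕜) × 𝕜 => p.1) (g := fun w => w j)
          (by fun_prop) (by fun_prop)
      by_cases hj : j = k
      · simp only [hj, if_true] at h3 ⊢; fun_prop
      · simpa only [hj, if_false, one_mul] using h3
    exact this.prod (by fun_prop)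
  · ext <;> simp
  · refine Tendsto.prodMk_nhds ?_ h2
    have := h1.update k hr
    simpa using this
  · filter_upwards [h] with i hi
    refine Prod.ext ?_ rfl
    ext j
    by_cases hj : j = k
    · subst hj; simp [hi]
    · simp [hj]

lemma mono_ite {σ : Type*} [Fintype σ] [DecidableEq σ] (α : σ → ℕ) (k : σ) (t : 𝕜) :
    mono α (fun j => if j = k then t else 1) = t ^ α k := by
  rw [mono, Finset.prod_eq_single k]
  · simp
  · intro j _ hj; simp [hj]
  · simp

lemma coeff_sum_C_mul_X_pow (d : ℕ → 𝕜) {n i : ℕ} (hi : i < n) :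
    (∑ j ∈ range n, Polynomial.C (d j) * Polynomial.X ^ j).coeff i = d i := by
  simp [Polynomial.finsetSum_coeff, hi]

lemma coeff_shifted (d : ℕ → 𝕜) (a c : 𝕜) (n : ℕ) :
    (Polynomial.C a * (Polynomial.X + Polynomial.C c) ^ (n + 1) +
      ∑ j ∈ range n, Polynomial.C (d j) * (Polynomial.X + Polynomial.C c) ^ j).coeff n =
      a * (c * (n + 1)) := by
  have h : ∀ j ∈ range n,
      (Polynomial.C (d j) * (Polynomial.X + Polynomial.C c) ^ j).coeff n = 0 := by
    intro j hj
    rw [Polynomial.coeff_C_mul, Polynomial.coeff_X_add_C_pow,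
      Nat.choose_eq_zero_of_lt (Finset.mem_range.mp hj)]
    simp
  rw [Polynomial.coeff_add, Polynomial.finsetSum_coeff, Finset.sum_eq_zero h,
    Polynomial.coeff_C_mul, Polynomial.coeff_X_add_C_pow]
  simp

lemma not_bounded_ratio {l : Ultrafilter ι} {z w : ι → 𝕜}
    (h : ¬ ∃ C : ℝ, ∀ᶠ i in l, ‖z i‖ ≤ C * ‖w i‖) :
    ∃ r : ι → 𝕜, Tendsto r l (𝓝 0) ∧ ∀ᶠ i in l, z i * r i = w i := by
  have h' : ∀ C : ℝ, ∀ᶠ i in l, C * ‖w i‖ < ‖z i‖ := by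
    intro C
    have := Ultrafilter.eventually_not.mpr fun hC => h ⟨C, hC⟩
    simpa using this
  refine ⟨fun i => w i / z i, ?_, ?_⟩
  · rw [Metric.tendsto_nhds]
    intro ε hε
    filter_upwards [h' ε⁻¹, h' 0] with i hi hi0
    have hz : 0 < ‖z i‖ := by simpa using hi0
    rw [dist_zero_right, norm_div, div_lt_iff₀ hz]
    rwa [inv_mul_lt_iff₀ hε] at hi
  · filter_upwards [h' 0] with i hi
    have hz : z i ≠ 0 := by simpa using hi
    field_simp

lemma bounded_ratio {l : Ultrafilter ι} {z w : ι → 𝕜}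
    (h : ∃ C : ℝ, ∀ᶠ i in l, ‖z i‖ ≤ C * ‖w i‖) :
    ∃ (q : ι → 𝕜) (c : 𝕜), Tendsto q l (𝓝 c) ∧ ∀ᶠ i in l, w i * q i = z i := by
  obtain ⟨C, hC⟩ := h
  have hq : ∀ᶠ i in l, z i / w i ∈ Metric.closedBall (0 : 𝕜) (max C 0) ∧ w i * (z i / w i) = z i := by
    filter_upwards [hC] with i hi
    by_cases hw : w i = 0
    · have hz : z i = 0 := by simpa [hw] using hi
      simp [hw, hz]
    · rw [mem_closedBall_zero_iff, norm_div, div_le_iff₀ (norm_pos_iff.mpr hw)]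
      exact ⟨hi.trans (by gcongr; exact le_max_left _ _), by field_simp⟩
  obtain ⟨c, -, hc⟩ := (isCompact_closedBall (0 : 𝕜) (max C 0)).ultrafilter_le_nhds
    (l.map fun i => z i / w i)
    (by rw [Filter.le_principal_iff]; exact hq.mono fun i hi => hi.1)
  exact ⟨_, c, hc, hq.mono fun i hi => hi.2⟩

lemma analyticAt_comp_fst {b : (Fin e → 𝕜) → 𝕜} (hb : AnalyticAt 𝕜 b 0) :
    AnalyticAt 𝕜 (fun p : (Fin e → 𝕜) × 𝕜 => b p.1) 0 :=
  AnalyticAt.fun_comp (f := fun p : (Fin e → 𝕜) × 𝕜 => p.1) hb (by fun_prop)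

lemma MonomializableOfOrder.of_normal_form {l : Ultrafilter ι} {n : ℕ}
    (hR : MonomializableOfOrder 𝕜 (l : Filter ι) e (n + 1)) (γ κ : Fin e → ℕ)
    {u : (Fin e → 𝕜) × 𝕜 → 𝕜} (hu : AnalyticAt 𝕜 u 0) (hu0 : u 0 ≠ 0)
    {b : ℕ → (Fin e → 𝕜) → 𝕜} (hb : ∀ i, AnalyticAt 𝕜 (b i) 0) (hb0 : ∃ i < n, b i 0 ≠ 0)
    {x : ι → (Fin e → 𝕜) × 𝕜} (hx : Tendsto x l (𝓝 0)) :
    MonAlong 𝕜 l (Fin (e + 1)) (fun p => mono κ p.1 * (p.2 ^ (n + 1) * u p +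
      ∑ i ∈ range n, mono γ p.1 ^ (n + 1 - i) * b i p.1 * p.2 ^ i)) x := by
  induction hN : ∑ k, γ k generalizing γ κ u x with
  | zero =>
    have hγ : γ = 0 := by ext i; simpa using Finset.sum_eq_zero_iff.mp hN i (Finset.mem_univ i)
    subst hγ
    obtain ⟨i, hi, hbi⟩ := hb0
    refine hR (mono κ) _ x (by fun_prop) (not_eventually_mono_eq_zero κ) ?_ ?_ hx
    · have hb' := fun i => analyticAt_comp_fst (hb i)
      simp only [mono_zero, one_pow, one_mul]
      have := Finset.analyticAt_fun_sum (𝕜 := 𝕜) (range n)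
        (f := fun i (p : (Fin e → 𝕜) × 𝕜) => b i p.1 * p.2 ^ i) (c := 0)
        fun i _ => (hb' i).fun_mul (by fun_prop)
      fun_prop
    · refine ⟨i, by omega, iteratedDeriv_ne_zero_of_coeff (v := fun t => u (0, t))
        (P := ∑ j ∈ range n, Polynomial.C (b j 0) * Polynomial.X ^ j) (m := n + 1) ?_ (by omega)
        (by rwa [coeff_sum_C_mul_X_pow (fun j => b j 0) hi]) (Eventually.of_forall fun t => ?_)⟩
      · exact AnalyticAt.fun_comp (f := fun t : 𝕜 => ((0 : Fin e → 𝕜), t)) hu (by fun_prop)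
      · simp [Polynomial.eval_finsetSum, mono_zero]
  | succ N ih =>
    obtain ⟨k, hk⟩ : ∃ k, γ k ≠ 0 := by
      by_contra! hcon
      simp [hcon] at hN
    have hγ0 : γ ≠ 0 := fun h => hk (by simp [h])
    by_cases hbd : ∃ C : ℝ, ∀ᶠ i in l, ‖(x i).2‖ ≤ C * ‖(x i).1 k‖
    · obtain ⟨γ', rfl⟩ : ∃ γ', γ = γ' + Pi.single k 1 := by
        refine ⟨γ - Pi.single k 1, (tsub_add_cancel_of_le ?_).symm⟩
        intro j
        by_cases hj : j = k
        · subst hj; simpa using Nat.one_le_iff_ne_zero.mpr hk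
        · simp [hj]
      have hN' : ∑ k, γ' k = N := by
        simpa [Finset.sum_add_distrib] using hN
      obtain ⟨q, c, hq, hqx⟩ := bounded_ratio hbd
      have hl := isLift_blowup_param hx hq hqx
      refine MonAlong.of_lift hl ?_
      have hu' := hl.analyticAt_comp hu
      set κ' := κ + Pi.single k (n + 1) with hκ'
      set G : (Fin e → 𝕜) × 𝕜 → 𝕜 := fun p => (p.2 + c) ^ (n + 1) * u (p.1, p.1 k * (p.2 + c)) +
        ∑ i ∈ range n, mono γ' p.1 ^ (n + 1 - i) * b i p.1 * (p.2 + c) ^ i with hG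
      refine MonAlong.congr (F := fun p => mono κ' p.1 * G p) ?_ (Eventually.of_forall fun p => ?_)
      · by_cases hc : c = 0
        · subst hc
          simp only [hG, add_zero] at hu' ⊢
          exact ih γ' κ' hu' (by simpa [Prod.mk_zero_zero] using hu0) (by simpa using hl.2.2.1) hN'
        · refine hR (mono κ') G _ (by fun_prop) (not_eventually_mono_eq_zero κ') ?_ ?_ hl.2.2.1
          · have hb' := fun i => analyticAt_comp_fst (hb i)
            have := Finset.analyticAt_fun_sum (𝕜 := 𝕜) (range n)
              (f := fun i (p : (Fin e → 𝕜) × 𝕜) =>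
                mono γ' p.1 ^ (n + 1 - i) * b i p.1 * (p.2 + c) ^ i) (c := 0)
              fun i _ => (AnalyticAt.fun_mul (by fun_prop) (hb' i)).fun_mul (by fun_prop)
            exact (AnalyticAt.fun_mul (by fun_prop) hu').fun_add this
          · refine ⟨n, by omega, iteratedDeriv_ne_zero_of_coeff (v := fun t => 0)
              analyticAt_const (Nat.lt_succ_self n) (P := _)
              (by rw [coeff_shifted (fun i => mono γ' 0 ^ (n + 1 - i) * b i 0) (u 0) c n]
                  exact mul_ne_zero hu0 (mul_ne_zero hc (by exact_mod_cast n.succ_ne_zero)))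
              (Eventually.of_forall fun t => ?_)⟩
            simp [hG, Polynomial.eval_finsetSum, mul_comm, Prod.mk_zero_zero]
      · simp only [hG, hκ', mono_add, mono_single]
        generalize p.2 + c = q
        rw [mul_add, mul_add, mul_sum, mul_sum]
        congr 1
        · ring
        · refine Finset.sum_congr rfl fun i hi => ?_
          have : p.1 k ^ (n + 1) = p.1 k ^ (n + 1 - i) * p.1 k ^ i := by
            rw [← pow_add]; congr 1; have := Finset.mem_range.mp hi; omega
          rw [this, mul_pow, mul_pow, pow_one]
          ring
    · obtain ⟨r, hr, hrx⟩ := not_bounded_ratio hbd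
      have hl := isLift_blowup_last hx hr hrx
      refine MonAlong.of_lift hl ?_
      set ψ : (Fin e → 𝕜) × 𝕜 → (Fin e → 𝕜) := fun p j => (if j = k then p.2 else 1) * p.1 j with hψ
      have hmono : ∀ α p, mono α (ψ p) = p.2 ^ α k * mono α p.1 := fun α p => by
        rw [hψ, mono_mul, mono_ite]
      have hψ0 : ψ 0 = 0 := by ext; simp [hψ]
      have hψa : AnalyticAt 𝕜 ψ 0 := hl.1.fst_comp
      obtain ⟨s, hs⟩ := Nat.exists_eq_succ_of_ne_zero hk
      refine MonAlong.of_prod hl.2.2.1 (u := fun p => u (ψ p, p.2) +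
        ∑ i ∈ range n, (p.2 ^ s * mono γ p.1) ^ (n + 1 - i) * b i (ψ p)) (α := κ)
        (m := κ k + (n + 1)) ?_ ?_ (Eventually.of_forall fun p => ?_)
      · refine (hl.analyticAt_comp hu).fun_add (Finset.analyticAt_fun_sum _ fun i _ => ?_)
        have : AnalyticAt 𝕜 (fun p => b i (ψ p)) 0 :=
          AnalyticAt.fun_comp (by rw [hψ0]; exact hb i) hψa
        exact AnalyticAt.fun_mul (by fun_prop) this
      · rw [Finset.sum_eq_zero]
        · simpa [hψ0, Prod.mk_zero_zero] using hu0
        · intro i hi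
          have := Finset.mem_range.mp hi
          have h2 : n + 1 - i ≠ 0 := by omega
          simp [mono_apply_zero hγ0, h2]
      · change mono κ (ψ p) * (p.2 ^ (n + 1) * u (ψ p, p.2) +
          ∑ i ∈ range n, mono γ (ψ p) ^ (n + 1 - i) * b i (ψ p) * p.2 ^ i) = _
        simp only [hmono, hs]
        rw [mul_add, add_mul, mul_sum, sum_mul]
        congr 1
        · ring
        · refine Finset.sum_congr rfl fun i hi => ?_
          have : p.2 ^ (n + 1) = p.2 ^ (n + 1 - i) * p.2 ^ i := by
            rw [← pow_add]; congr 1; have := Finset.mem_range.mp hi; omega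
          rw [pow_add p.2 (κ k), this, pow_succ p.2 s, mul_pow, mul_pow, mul_pow]
          ring

end Reduction

/-! ### Induction on the order -/

section Induction

variable {𝕜 : Type*} [RCLike 𝕜] {ι : Type*} {e : ℕ}

lemma tendsto_fst_nhds_zero {l : Filter ι} {x : ι → (Fin e → 𝕜) × 𝕜} (hx : Tendsto x l (𝓝 0)) :
    Tendsto (fun i => (x i).1) l (𝓝 0) :=
  (Continuous.tendsto' continuous_fst (0 : (Fin e → 𝕜) × 𝕜) 0 rfl).comp hx

lemma eventually_fst {P : (Fin e → 𝕜) → Prop} (h : ∀ᶠ w in 𝓝 0, P w) :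
    ∀ᶠ p : (Fin e → 𝕜) × 𝕜 in 𝓝 0, P p.1 :=
  (Continuous.tendsto' continuous_fst (0 : (Fin e → 𝕜) × 𝕜) 0 rfl).eventually h

lemma MonAlong.mul_of_ne_zero {l : Filter ι} (hM : Monomializable 𝕜 l e) {h : (Fin e → 𝕜) → 𝕜}
    {g : (Fin e → 𝕜) × 𝕜 → 𝕜} {x : ι → (Fin e → 𝕜) × 𝕜} (hh : AnalyticAt 𝕜 h 0)
    (hh0 : ¬ ∀ᶠ p in 𝓝 0, h p = 0) (hg : AnalyticAt 𝕜 g 0) (hg0 : g 0 ≠ 0)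
    (hx : Tendsto x l (𝓝 0)) : MonAlong 𝕜 l (Fin (e + 1)) (fun p => h p.1 * g p) x := by
  obtain ⟨π, y, hl, κ, v, hv, hv0, hm⟩ := hM h _ hh hh0 (tendsto_fst_nhds_zero hx)
  have hl' := hl.prodMap_id hx
  refine MonAlong.of_lift hl' (MonAlong.of_prod hl'.2.2.1 (u := fun p => v p.1 * g (π p.1, p.2))
    (α := κ) (m := 0) ((analyticAt_comp_fst hv).mul (hl'.analyticAt_comp hg)) ?_ ?_)
  · have : g (π 0, 0) ≠ 0 := by rw [hl.2.1]; exact hg0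
    exact mul_ne_zero hv0 this
  · filter_upwards [eventually_fst hm] with p hp
    rw [hp]
    ring

lemma Monomializable.ofOrder {l : Ultrafilter ι} (hM : Monomializable 𝕜 (l : Filter ι) e)
    (n : ℕ) : MonomializableOfOrder 𝕜 (l : Filter ι) e n := by
  induction n with
  | zero => rintro h g x - - - ⟨k, hk, -⟩; omega
  | succ n ih =>
    intro h g x hh hh0 hg hgn hx
    by_cases hlt : ∃ k < n, vderiv k g 0 ≠ 0
    · exact ih h g x hh hh0 hg hlt hx
    push Not at hlt
    have hn : vderiv n g 0 ≠ 0 := by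
      obtain ⟨k, hk, hk0⟩ := hgn
      obtain rfl : k = n := by
        by_contra hne
        exact hk0 (hlt k (by omega))
      exact hk0
    cases n with
    | zero => exact MonAlong.mul_of_ne_zero hM hh hh0 hg (by simpa [vderiv_zero] using hn) hx
    | succ n =>
      obtain ⟨φ, u, a, hφ, hφ0, hu, hu0, ha, hnf⟩ := hg.exists_normal_form hlt hn
      have hφ' := analyticAt_comp_fst hφ
      have hT : IsLift 𝕜 (l : Filter ι) (fun p : (Fin e → 𝕜) × 𝕜 => (p.1, p.2 + φ p.1))
          (fun i => ((x i).1, (x i).2 - φ (x i).1)) x := by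
        refine ⟨by fun_prop, by simp [hφ0], ?_, by simp⟩
        have : Tendsto (fun p : (Fin e → 𝕜) × 𝕜 => (p.1, p.2 - φ p.1)) (𝓝 0) (𝓝 0) := by
          have : ContinuousAt (fun p : (Fin e → 𝕜) × 𝕜 => (p.1, p.2 - φ p.1)) 0 :=
            AnalyticAt.continuousAt (𝕜 := 𝕜) (by fun_prop)
          simpa [ContinuousAt, hφ0, Prod.mk_zero_zero] using this
        exact this.comp hx
      refine MonAlong.of_lift hT ?_
      obtain ⟨π, y, hl, ⟨κ, v, hv, hv0, hm⟩, hcase⟩ := hM.exists_comparable n hh hh0 ha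
        (tendsto_fst_nhds_zero hT.2.2.1)
      have hl' := hl.prodMap_id hT.2.2.1
      refine MonAlong.of_lift hl' ?_
      have hu' := hl'.analyticAt_comp hu
      have hu0' : u (π 0, 0) ≠ 0 := by rw [hl.2.1]; exact hu0
      have hnf' := hl'.tendsto_nhds.eventually hnf
      have hv' := analyticAt_comp_fst hv
      rcases hcase with hzero | ⟨γ, b, hb, hb0, hab⟩
      · refine MonAlong.of_prod hl'.2.2.1 (u := fun p => v p.1 * u (π p.1, p.2)) (α := κ)
          (m := n + 1) (hv'.mul hu') (mul_ne_zero hv0 hu0') ?_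
        have hz : ∀ᶠ w in 𝓝 (0 : Fin e → 𝕜), ∀ i ∈ range n, a i (π w) = 0 :=
          (Filter.eventually_all_finset _).mpr fun i hi => hzero i (mem_range.mp hi)
        filter_upwards [hnf', eventually_fst hm, eventually_fst hz] with p hp hpm hpz
        rw [hp, hpm, Finset.sum_eq_zero fun i hi => by rw [hpz i hi, zero_mul]]
        ring
      · have hab' : ∀ᶠ w in 𝓝 (0 : Fin e → 𝕜), ∀ i ∈ range n,
            a i (π w) = mono γ w ^ (n + 1 - i) * b i w :=
          (Filter.eventually_all_finset _).mpr fun i hi => hab i (mem_range.mp hi)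
        refine ((MonomializableOfOrder.of_normal_form ih γ κ hu' hu0' hb hb0
          hl'.2.2.1).unit_mul hv' hv0).congr ?_
        filter_upwards [hnf', eventually_fst hm, eventually_fst hab'] with p hp hpm hpa
        rw [hp, hpm, Finset.sum_congr rfl fun i hi => by rw [hpa i hi]]
        ring

end Induction

/-! ### Induction on the number of variables -/

section Dimension

variable {𝕜 : Type*} [RCLike 𝕜] {ι : Type*} {e : ℕ}

lemma exists_line_not_eventually_eq_zero {V : Type*} [NormedAddCommGroup V] [NormedSpace 𝕜 V]
    [Nontrivial V] {F : V → 𝕜} (hF : AnalyticAt 𝕜 F 0) (h0 : ¬ ∀ᶠ p in 𝓝 0, F p = 0) :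
    ∃ v : V, v ≠ 0 ∧ ¬ ∀ᶠ t : 𝕜 in 𝓝 0, F (t • v) = 0 := by
  by_cases hF0 : F 0 = 0
  · obtain ⟨r, hr, hball⟩ := Metric.eventually_nhds_iff_ball.mp hF.eventually_analyticAt
    obtain ⟨v, hv, hvr⟩ := ((not_eventually.mp h0).and_eventually (Metric.ball_mem_nhds 0 hr)).exists
    have hv0 : v ≠ 0 := fun h => hv (h ▸ hF0)
    have hn : 0 < ‖v‖ := norm_pos_iff.mpr hv0
    refine ⟨v, hv0, fun hev => hv ?_⟩
    have han : AnalyticOnNhd 𝕜 (fun t : 𝕜 => F (t • v)) (Metric.ball 0 (r / ‖v‖)) := by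
      intro t ht
      refine AnalyticAt.fun_comp (f := fun t : 𝕜 => t • v) (hball _ ?_) (by fun_prop)
      rw [mem_ball_zero_iff] at ht ⊢
      rw [norm_smul]
      rwa [lt_div_iff₀ hn] at ht
    have := han.eqOn_zero_of_preconnected_of_eventuallyEq_zero
      (convex_ball (0 : 𝕜) _).isPreconnected (Metric.mem_ball_self (by positivity)) hev
      (x := 1) (by
        rw [mem_ball_zero_iff, norm_one, lt_div_iff₀ hn]
        simpa using hvr)
    simpa using this
  · obtain ⟨v, hv⟩ := exists_ne (0 : V)
    exact ⟨v, hv, fun h => hF0 (by simpa using h.self_of_nhds)⟩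

lemma AnalyticAt.exists_iteratedDeriv_ne_zero {f : 𝕜 → 𝕜} (hf : AnalyticAt 𝕜 f 0)
    (h0 : ¬ ∀ᶠ t in 𝓝 0, f t = 0) : ∃ m, iteratedDeriv m f 0 ≠ 0 := by
  by_contra! h
  refine h0 (analyticOrderAt_eq_top.mp (ENat.eq_top_iff_forall_ge.mpr fun m => ?_))
  exact (natCast_le_analyticOrderAt_iff_iteratedDeriv_eq_zero hf).mpr fun i _ => h i

lemma Monomializable.succ {l : Ultrafilter ι} (hM : Monomializable 𝕜 (l : Filter ι) e) :
    Monomializable 𝕜 (l : Filter ι) (e + 1) := by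
  intro F x hF hF0 hx
  obtain ⟨v, hv0, hv⟩ := exists_line_not_eventually_eq_zero hF hF0
  obtain ⟨A, hA⟩ : ∃ A : ((Fin e → 𝕜) × 𝕜) ≃L[𝕜] (Fin (e + 1) → 𝕜), A (0, 1) = v := by
    have A₀ : ((Fin e → 𝕜) × 𝕜) ≃L[𝕜] (Fin (e + 1) → 𝕜) :=
      ContinuousLinearEquiv.ofFinrankEq (by simp)
    obtain ⟨B, hB⟩ := SeparatingDual.exists_continuousLinearEquiv_apply_eq (R := 𝕜)
      (x := A₀ (0, 1)) (by simp) hv0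
    exact ⟨A₀.trans B, hB⟩
  have hl : IsLift 𝕜 (l : Filter ι) A (fun i => A.symm (x i)) x := by
    refine ⟨A.analyticAt 0, map_zero A, ?_, by simp⟩
    exact (Continuous.tendsto' A.symm.continuous 0 0 (map_zero _)).comp hx
  have hline : ∀ t : 𝕜, F (A (0, t)) = F (t • v) := fun t => by
    rw [← hA, ← map_smul]; simp
  obtain ⟨m, hm⟩ := AnalyticAt.exists_iteratedDeriv_ne_zero (f := fun t => F (A (0, t)))
    (AnalyticAt.fun_comp (f := fun t : 𝕜 => ((0 : Fin e → 𝕜), t)) (hl.analyticAt_comp hF)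
      (by fun_prop)) (by simpa only [hline] using hv)
  refine MonAlong.of_lift hl ?_
  refine (hM.ofOrder (m + 1) (fun _ => 1) (fun p => F (A p)) _ analyticAt_const ?_
    (hl.analyticAt_comp hF) ⟨m, by omega, hm⟩ hl.2.2.1).congr (by simp)
  simpa using NeBot.ne inferInstance

theorem monomializable (l : Ultrafilter ι) (e : ℕ) : Monomializable 𝕜 (l : Filter ι) e := by
  induction e with
  | zero =>
    intro F x hF hF0 hx
    have hF1 : F 0 ≠ 0 := fun h => hF0 (Eventually.of_forall fun p => by
      rwa [Subsingleton.elim p 0])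
    exact ⟨id, x, ⟨analyticAt_id, rfl, hx, by simp⟩, 0, F, hF, hF1,
      Eventually.of_forall fun p => by rw [mono_zero, mul_one]; rfl⟩
  | succ e ih => exact ih.succ

end Dimension

/-! ### The gradient of a monomial -/

section Gradient

variable {𝕜 : Type*} [RCLike 𝕜] {d : ℕ}

lemma fderiv_mul_mono_single {u : (Fin d → 𝕜) → 𝕜} {y : Fin d → 𝕜}
    (hu : DifferentiableAt 𝕜 u y) (α : Fin d → ℕ) (i : Fin d) :
    fderiv 𝕜 (fun z => u z * mono α z) y (Pi.single i (y i)) =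
      (α i * u y + fderiv 𝕜 u y (Pi.single i (y i))) * mono α y := by
  set w : Fin d → 𝕜 := Pi.single i (y i) with hw
  have hline : HasDerivAt (fun t : 𝕜 => y + t • w) w 0 := by
    simpa using ((hasDerivAt_id (0 : 𝕜)).smul_const w).const_add y
  have h0 : y + (0 : 𝕜) • w = y := by simp
  have hm : DifferentiableAt 𝕜 (fun z => u z * mono α z) y :=
    hu.mul (AnalyticAt.differentiableAt (by fun_prop))
  have h1 : HasDerivAt (fun t : 𝕜 => u (y + t • w) * mono α (y + t • w))
      (fderiv 𝕜 (fun z => u z * mono α z) y w) 0 :=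
    HasFDerivAt.comp_hasDerivAt (x := (0 : 𝕜)) (l := fun z => u z * mono α z)
      (by rw [h0]; exact hm.hasFDerivAt) hline
  have h2 : HasDerivAt (fun t : 𝕜 => u (y + t • w)) (fderiv 𝕜 u y w) 0 :=
    HasFDerivAt.comp_hasDerivAt (x := (0 : 𝕜)) (l := u)
      (by rw [h0]; exact hu.hasFDerivAt) hline
  have hscale : ∀ t : 𝕜, mono α (y + t • w) = (1 + t) ^ α i * mono α y := by
    intro t
    rw [← mono_ite, ← mono_mul]
    congr 1
    ext j
    by_cases hj : j = i
    · subst hj; simp [hw]; ring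
    · simp [hw, hj]
  have h3 : HasDerivAt (fun t : 𝕜 => (1 + t) ^ α i * mono α y) (α i * mono α y) 0 := by
    have := (((hasDerivAt_id (0 : 𝕜)).const_add 1).pow (α i)).mul_const (mono α y)
    simpa using this
  simp only [hscale] at h1
  rw [h1.unique (h2.mul h3), h0]
  simp
  ring

lemma exists_norm_pow_le_norm_mono {α : Fin d → ℕ} (hα : α ≠ 0) (y : Fin d → 𝕜) :
    ∃ i, α i ≠ 0 ∧ ‖y i‖ ^ (∑ j, α j) ≤ ‖mono α y‖ := by
  have hS : (Finset.univ.filter fun i => α i ≠ 0).Nonempty := by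
    obtain ⟨i, hi⟩ := Function.ne_iff.mp hα
    exact ⟨i, by simpa using hi⟩
  obtain ⟨i, hi, hmin⟩ := Finset.exists_min_image _ (fun i => ‖y i‖) hS
  refine ⟨i, by simpa using hi, ?_⟩
  rw [mono, norm_prod, ← Finset.prod_pow_eq_pow_sum]
  refine Finset.prod_le_prod (fun j _ => by positivity) fun j _ => ?_
  rw [norm_pow]
  by_cases hj : α j = 0
  · simp [hj]
  · exact pow_le_pow_left₀ (norm_nonneg _) (hmin j (by simpa using hj)) _

lemma IsMonomialAt.gradient_inequality {G : (Fin d → 𝕜) → 𝕜} (hG : IsMonomialAt G)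
    (hG0 : G 0 = 0) : ∃ m : ℕ, ∃ c : ℝ, 0 < c ∧
      ∀ᶠ y in 𝓝 0, c * ‖G y‖ ^ (1 - 1 / ((m : ℝ) + 1)) ≤ ‖fderiv 𝕜 G y‖ := by
  obtain ⟨α, u, hu, hu0, hev⟩ := hG
  have hα : α ≠ 0 := by
    rintro rfl
    have := hev.self_of_nhds
    rw [hG0, mono_zero, mul_one] at this
    exact hu0 this.symm
  set m := ∑ j, α j with hm
  have hm0 : m ≠ 0 := by
    intro h
    refine hα (funext fun j => ?_)
    exact Finset.sum_eq_zero_iff.mp h j (Finset.mem_univ j)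
  have hn : 0 < ‖u 0‖ := norm_pos_iff.mpr hu0
  set c₁ := ‖u 0‖ / 2 with hc₁
  have hc₁0 : 0 < c₁ := by positivity
  have hupper : ∀ᶠ y in 𝓝 (0 : Fin d → 𝕜), c₁ < ‖u y‖ :=
    hu.continuousAt.norm.eventually_const_lt (by simp only [hc₁]; linarith)
  have hsmall : ∀ᶠ y in 𝓝 (0 : Fin d → 𝕜), ‖fderiv 𝕜 u y‖ * ‖y‖ < c₁ / 2 := by
    have : ContinuousAt (fun y => ‖fderiv 𝕜 u y‖ * ‖y‖) 0 :=
      hu.fderiv.continuousAt.norm.mul continuousAt_id.norm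
    exact this.eventually_lt_const (by simpa using hc₁0)
  have hone : ∀ᶠ y in 𝓝 (0 : Fin d → 𝕜), ‖y‖ < 1 :=
    continuousAt_id.norm.eventually_lt_const (by simp)
  have hmpos : (0 : ℝ) < m := by exact_mod_cast Nat.pos_of_ne_zero hm0
  set s : ℝ := 1 / ((m : ℝ) + 1) with hs
  have hs1 : s < 1 := by rw [hs, div_lt_one (by positivity)]; linarith
  have hs0 : 0 < s := by positivity
  refine ⟨m, c₁ ^ s / 2, by positivity, ?_⟩
  filter_upwards [hev.eventually_nhds, hupper, hsmall, hone, hu.eventually_analyticAt]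
    with y hy hyu hys hy1 hya
  by_cases hGy : G y = 0
  · rw [hGy, norm_zero, Real.zero_rpow (by linarith), mul_zero]
    exact norm_nonneg _
  have hgpos : 0 < ‖G y‖ := norm_pos_iff.mpr hGy
  obtain ⟨i, hi, hle⟩ := exists_norm_pow_le_norm_mono hα y
  have hyi : ‖y i‖ ≤ ‖y‖ := norm_le_pi_norm y i
  have hGeq : G y = u y * mono α y := hy.self_of_nhds
  have hfd : fderiv 𝕜 G y = fderiv 𝕜 (fun z => u z * mono α z) y :=
    Filter.EventuallyEq.fderiv_eq hy
  have hdir : ‖G y‖ / 2 ≤ ‖fderiv 𝕜 G y‖ * ‖y i‖ := by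
    have h1 := (fderiv 𝕜 G y).le_opNorm (Pi.single i (y i))
    rw [Pi.norm_single] at h1
    refine le_trans ?_ h1
    rw [hfd, fderiv_mul_mono_single hya.differentiableAt, hGeq, norm_mul, norm_mul,
      mul_div_right_comm]
    refine mul_le_mul_of_nonneg_right ?_ (norm_nonneg _)
    have h2 := (fderiv 𝕜 u y).le_opNorm (Pi.single i (y i))
    rw [Pi.norm_single] at h2
    have h3 : ‖fderiv 𝕜 u y‖ * ‖y i‖ ≤ ‖fderiv 𝕜 u y‖ * ‖y‖ := by gcongr
    have h4 : ‖u y‖ ≤ ‖(α i : 𝕜) * u y‖ := by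
      rw [norm_mul, RCLike.norm_natCast]
      have : (1 : ℝ) ≤ α i := by exact_mod_cast Nat.one_le_iff_ne_zero.mpr hi
      nlinarith [norm_nonneg (u y)]
    have h5 := norm_sub_le_norm_add ((α i : 𝕜) * u y) (fderiv 𝕜 u y (Pi.single i (y i)))
    linarith
  have hroot : c₁ ^ s * ‖y i‖ ≤ ‖G y‖ ^ s := by
    have h1 : c₁ * ‖y i‖ ^ (m + 1) ≤ ‖G y‖ := by
      rw [hGeq, norm_mul]
      refine mul_le_mul hyu.le (le_trans ?_ hle) (by positivity) (norm_nonneg _)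
      exact pow_le_pow_of_le_one (norm_nonneg _) (hyi.trans hy1.le) (Nat.le_succ m)
    have h2 := Real.rpow_le_rpow (by positivity) h1 hs0.le
    rw [Real.mul_rpow hc₁0.le (by positivity)] at h2
    have h3 : (‖y i‖ ^ (m + 1)) ^ s = ‖y i‖ := by
      rw [hs, one_div]
      exact_mod_cast Real.pow_rpow_inv_natCast (norm_nonneg (y i)) m.succ_ne_zero
    rwa [h3] at h2
  have hsplit : ‖G y‖ ^ (1 - s) * ‖G y‖ ^ s = ‖G y‖ := by
    rw [← Real.rpow_add hgpos, sub_add_cancel, Real.rpow_one]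
  have hsp : 0 < ‖G y‖ ^ s := by positivity
  refine le_of_mul_le_mul_right ?_ hsp
  have hcs : 0 < c₁ ^ s := by positivity
  calc c₁ ^ s / 2 * ‖G y‖ ^ (1 - s) * ‖G y‖ ^ s = c₁ ^ s * (‖G y‖ / 2) := by
        rw [mul_assoc, hsplit]; ring
    _ ≤ c₁ ^ s * (‖fderiv 𝕜 G y‖ * ‖y i‖) := by gcongr
    _ = ‖fderiv 𝕜 G y‖ * (c₁ ^ s * ‖y i‖) := by ring
    _ ≤ ‖fderiv 𝕜 G y‖ * ‖G y‖ ^ s := by gcongr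

end Gradient

/-! ### The gradient inequality -/

section Main

variable {𝕜 : Type*} [RCLike 𝕜] {d : ℕ}

theorem AnalyticAt.gradient_inequality_zero {F : (Fin d → 𝕜) → 𝕜} (hF : AnalyticAt 𝕜 F 0)
    (hF0 : F 0 = 0) : ∃ n : ℕ, ∀ᶠ x in 𝓝 0,
      1 / ((n : ℝ) + 1) * ‖F x‖ ^ (1 - 1 / ((n : ℝ) + 2)) ≤ ‖fderiv 𝕜 F x‖ := by
  have hexp : ∀ n : ℕ, (0 : ℝ) < 1 - 1 / ((n : ℝ) + 2) := fun n => by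
    rw [sub_pos, div_lt_one (by positivity)]
    linarith [(Nat.cast_nonneg n : (0 : ℝ) ≤ n)]
  by_cases hz : ∀ᶠ x in 𝓝 0, F x = 0
  · refine ⟨0, hz.mono fun x hx => ?_⟩
    rw [hx, norm_zero, Real.zero_rpow (hexp 0).ne', mul_zero]
    exact norm_nonneg _
  by_contra! hcon
  have hchoose : ∀ n : ℕ, ∃ x : Fin d → 𝕜, ‖x‖ < 1 / ((n : ℝ) + 1) ∧
      ‖fderiv 𝕜 F x‖ < 1 / ((n : ℝ) + 1) * ‖F x‖ ^ (1 - 1 / ((n : ℝ) + 2)) := by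
    intro n
    obtain ⟨x, hx, hxb⟩ := (hcon n).and_eventually
      (Metric.ball_mem_nhds (0 : Fin d → 𝕜) (Nat.one_div_pos_of_nat (n := n)))
    |>.exists
    exact ⟨x, by simpa using hxb, hx⟩
  choose x hxs hx using hchoose
  set l : Ultrafilter ℕ := hyperfilter ℕ with hl_def
  have hlat : (l : Filter ℕ) ≤ atTop := by
    rw [← Nat.cofinite_eq_atTop]
    exact hyperfilter_le_cofinite
  have hxt : Tendsto x l (𝓝 0) :=
    (squeeze_zero_norm (fun n => (hxs n).le) tendsto_one_div_add_atTop_nhds_zero_nat).mono_left hlat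
  obtain ⟨π, y, hl, hm⟩ := monomializable l d F x hF hz hxt
  obtain ⟨m, c, hc, hG⟩ := hm.gradient_inequality (by simp only [hl.2.1, hF0])
  obtain ⟨K, hK⟩ : ∃ K, ∀ᶠ w in 𝓝 (0 : Fin d → 𝕜), ‖fderiv 𝕜 π w‖ < K :=
    ⟨‖fderiv 𝕜 π 0‖ + 1, hl.1.fderiv.continuousAt.norm.eventually_lt_const (lt_add_one _)⟩
  have hK0 : 0 < K := by
    exact (norm_nonneg _).trans_lt hK.self_of_nhds
  have hchain : ∀ᶠ w in 𝓝 (0 : Fin d → 𝕜),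
      ‖fderiv 𝕜 (fun w => F (π w)) w‖ ≤ ‖fderiv 𝕜 F (π w)‖ * ‖fderiv 𝕜 π w‖ := by
    filter_upwards [hl.1.eventually_analyticAt,
      hl.tendsto_nhds.eventually hF.eventually_analyticAt] with w hw hFw
    have : fderiv 𝕜 (fun w => F (π w)) w = (fderiv 𝕜 F (π w)).comp (fderiv 𝕜 π w) :=
      fderiv_fun_comp w hFw.differentiableAt hw.differentiableAt
    rw [this]
    exact ContinuousLinearMap.opNorm_comp_le _ _
  have hone : ∀ᶠ w in 𝓝 (0 : Fin d → 𝕜), ‖F (π w)‖ < 1 :=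
    (hl.analyticAt_comp hF).continuousAt.norm.eventually_lt_const (by simp [hl.2.1, hF0])
  have hlarge : ∀ᶠ n : ℕ in l, m ≤ n ∧ K / c ≤ n :=
    hlat ((eventually_ge_atTop m).and (tendsto_natCast_atTop_atTop.eventually_ge_atTop (K / c)))
  obtain ⟨n, hGn, hKn, hcn, h1n, hyn, hmn, hcK⟩ := (hl.2.2.1.eventually
    (hG.and (hK.and (hchain.and hone))) |>.and (hl.2.2.2.and hlarge) |>.mono
    fun n h => (⟨h.1.1, h.1.2.1, h.1.2.2.1, h.1.2.2.2, h.2.1, h.2.2⟩ : _ ∧ _ ∧ _ ∧ _ ∧ _ ∧ _)).exists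
  rw [hyn] at hGn hcn h1n
  have hpos : 0 < ‖F (x n)‖ := by
    rcases (norm_nonneg (F (x n))).eq_or_lt with h | h
    · have := hx n
      rw [← h, Real.zero_rpow (hexp n).ne', mul_zero] at this
      exact absurd this (not_lt.mpr (norm_nonneg _))
    · exact h
  set P := ‖F (x n)‖ ^ (1 - 1 / ((m : ℝ) + 1)) with hP
  have hP0 : 0 < P := by positivity
  have hle : ‖F (x n)‖ ^ (1 - 1 / ((n : ℝ) + 2)) ≤ P := by
    refine Real.rpow_le_rpow_of_exponent_ge hpos h1n.le ?_
    have : (m : ℝ) ≤ n := by exact_mod_cast hmn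
    gcongr
    linarith
  have h1 : c * P ≤ 1 / ((n : ℝ) + 1) * P * K := by
    calc c * P ≤ ‖fderiv 𝕜 F (x n)‖ * ‖fderiv 𝕜 π (y n)‖ := hGn.trans hcn
      _ ≤ (1 / ((n : ℝ) + 1) * P) * K := by
        gcongr
        exact (hx n).le.trans (by gcongr)
  have h2 : c * P * (n + 1) ≤ K * P := by
    calc c * P * (n + 1) ≤ 1 / ((n : ℝ) + 1) * P * K * (n + 1) := by gcongr
      _ = K * P := by field_simp
  have h3 : K ≤ c * n := by
    rw [div_le_iff₀ hc] at hcK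
    linarith
  nlinarith [mul_pos hc hP0, mul_le_mul_of_nonneg_right h3 hP0.le]

end Main

/-- **Łojasiewicz gradient inequality for an analytic function.**
Let `d ≥ 1`, `𝕜 = ℝ` or `ℂ`, `U ⊆ 𝕜^d` open, and `E : U → 𝕜` analytic. If `x∞ ∈ U`
satisfies `E'(x∞) = 0`, then there are constants `C₀ ∈ (0,∞)`, `σ₀ ∈ (0,1]` with
`B_{σ₀}(x∞) ⊆ U`, and `θ ∈ [1/2,1)` such that
`‖E'(x)‖ ≥ C₀ · |E(x) − E(x∞)|^θ` for all `x ∈ B_{σ₀}(x∞)`. -/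
theorem lojasiewicz_gradient_inequality_analytic
    (d : ℕ) (hd : 1 ≤ d) (𝕜 : Type) [RCLike 𝕜]
    (U : Set (EuclideanSpace 𝕜 (Fin d))) (hU : IsOpen U)
    (E : EuclideanSpace 𝕜 (Fin d) → 𝕜) (hE : AnalyticOnNhd 𝕜 E U)
    (x_inf : EuclideanSpace 𝕜 (Fin d)) (hx : x_inf ∈ U)
    (hcrit : fderiv 𝕜 E x_inf = 0) :
    ∃ C₀ : ℝ, 0 < C₀ ∧ ∃ σ₀ ∈ Set.Ioc (0:ℝ) 1, Metric.ball x_inf σ₀ ⊆ U ∧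
      ∃ θ ∈ Set.Ico (1/2 : ℝ) 1,
        ∀ x ∈ Metric.ball x_inf σ₀,
          ‖fderiv 𝕜 E x‖ ≥ C₀ * ‖E x - E x_inf‖ ^ θ := by
  set L : EuclideanSpace 𝕜 (Fin d) ≃L[𝕜] (Fin d → 𝕜) := EuclideanSpace.equiv (Fin d) 𝕜
  set A : (Fin d → 𝕜) → EuclideanSpace 𝕜 (Fin d) := fun w => x_inf + L.symm w with hA
  have hA0 : A 0 = x_inf := by simp [hA]
  have hAa : AnalyticAt 𝕜 A 0 := analyticAt_const.add (L.symm.analyticAt 0)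
  have hF : AnalyticAt 𝕜 (fun w => E (A w) - E x_inf) 0 :=
    (AnalyticAt.fun_comp (by rw [hA0]; exact hE x_inf hx) hAa).fun_sub analyticAt_const
  obtain ⟨n, hn⟩ := hF.gradient_inequality_zero (by simp [hA0])
  have hB : Tendsto (fun x => L (x - x_inf)) (𝓝 x_inf) (𝓝 0) :=
    Continuous.tendsto' (by fun_prop) _ _ (by simp)
  have hAB : ∀ x, A (L (x - x_inf)) = x := fun x => by simp [hA]
  obtain ⟨r, hr, hball⟩ := Metric.eventually_nhds_iff_ball.mp
    ((hB.eventually hn).and (hU.eventually_mem hx))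
  set K := ‖(L.symm : (Fin d → 𝕜) →L[𝕜] EuclideanSpace 𝕜 (Fin d))‖ + 1 with hK
  have hK0 : 0 < K := by positivity
  refine ⟨1 / ((n : ℝ) + 1) / K, by positivity, min r 1, ⟨lt_min hr one_pos, min_le_right _ _⟩,
    fun x hx => (hball x (Metric.ball_subset_ball (min_le_left _ _) hx)).2,
    1 - 1 / ((n : ℝ) + 2), ⟨?_, ?_⟩, fun x hxb => ?_⟩
  · have : 1 / ((n : ℝ) + 2) ≤ 1 / 2 := by gcongr; linarith [(Nat.cast_nonneg n : (0 : ℝ) ≤ n)]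
    linarith
  · have : 0 < 1 / ((n : ℝ) + 2) := by positivity
    linarith
  · obtain ⟨hgrad, hxU⟩ := hball x (Metric.ball_subset_ball (min_le_left _ _) hxb)
    have hfd : HasFDerivAt (fun w => E (A w) - E x_inf)
        ((fderiv 𝕜 E x).comp (L.symm : (Fin d → 𝕜) →L[𝕜] EuclideanSpace 𝕜 (Fin d)))
        (L (x - x_inf)) := by
      refine HasFDerivAt.sub_const _ (HasFDerivAt.comp (f := A) _ ?_ ?_)
      · rw [hAB]
        exact (hE x hxU).differentiableAt.hasFDerivAt
      · exact L.symm.hasFDerivAt.const_add x_inf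
    rw [hfd.fderiv, hAB] at hgrad
    rw [ge_iff_le, div_mul_eq_mul_div, div_le_iff₀ hK0]
    refine hgrad.trans ((ContinuousLinearMap.opNorm_comp_le _ _).trans ?_)
    gcongr
    exact (lt_add_one _).le
end

section
/- Let d ≥ 2 be an integer, 𝕂 = ℝ or ℂ, U ⊆ 𝕂^d an open neighborhood of the origin, and E : U → 𝕂 a C¹ function with simple normal crossings: E(x) = x₁^{n₁}···x_d^{n_d} f₀(x) on U with nonnegative integers n_i, at least one n_i ≥ 1, and f₀ C¹ with f₀(0) ≠ 0. If E'(0) = 0, then with N = n₁ + ⋯ + n_d (necessarily N ≥ 2) and θ = 1 − 1/N ∈ [1/2,1), there exist constants C₀ ∈ (0,∞) and σ ∈ (0,1] with B_σ ⊆ U such that ‖E'(x)‖ ≥ C₀ · |E(x)|^θ for all x ∈ B_σ. -/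
/-- The partial derivative of a monomial times a function, in a coordinate direction. -/
theorem fderiv_monomial_mul_apply_single {ι 𝕜 : Type*} [Fintype ι] [DecidableEq ι] [RCLike 𝕜]
    {E f : EuclideanSpace 𝕜 ι → 𝕜} {n : ι → ℕ} {x : EuclideanSpace 𝕜 ι}
    (hE : E =ᶠ[nhds x] fun y => (∏ i, (y i) ^ (n i)) * f y)
    (hf : DifferentiableAt 𝕜 f x) (j : ι) :
    fderiv 𝕜 E x (EuclideanSpace.single j 1) =
      (n j * (x j) ^ (n j - 1) * f x
        + (x j) ^ (n j) * fderiv 𝕜 f x (EuclideanSpace.single j 1))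
        * ∏ i ∈ Finset.univ.erase j, (x i) ^ (n i) := by
  have hEd : DifferentiableAt 𝕜 E x := by
    refine DifferentiableAt.congr_of_eventuallyEq ?_ hE
    fun_prop
  have hline : HasDerivAt (fun t : 𝕜 => x + t • EuclideanSpace.single j (1 : 𝕜))
      (EuclideanSpace.single j 1) 0 := by
    simpa using ((hasDerivAt_id (0 : 𝕜)).smul_const
      (EuclideanSpace.single j (1 : 𝕜))).const_add x
  have hEl : HasDerivAt (fun t : 𝕜 => E (x + t • EuclideanSpace.single j (1 : 𝕜)))
      (fderiv 𝕜 E x (EuclideanSpace.single j 1)) 0 :=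
    HasFDerivAt.comp_hasDerivAt_of_eq 0 hEd.hasFDerivAt hline (by simp)
  have hfl : HasDerivAt (fun t : 𝕜 => f (x + t • EuclideanSpace.single j (1 : 𝕜)))
      (fderiv 𝕜 f x (EuclideanSpace.single j 1)) 0 :=
    HasFDerivAt.comp_hasDerivAt_of_eq 0 hf.hasFDerivAt hline (by simp)
  have hpow : HasDerivAt (fun t : 𝕜 => (x j + t) ^ n j) (n j * (x j) ^ (n j - 1)) 0 := by
    simpa using ((hasDerivAt_id' (0 : 𝕜)).const_add (x j : 𝕜)).fun_pow (n j)
  have hprod := (hpow.mul hfl).mul_const (∏ i ∈ Finset.univ.erase j, (x i) ^ (n i))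
  have htend : Filter.Tendsto (fun t : 𝕜 => x + t • EuclideanSpace.single j (1 : 𝕜))
      (nhds 0) (nhds x) := by
    simpa using hline.continuousAt.tendsto
  have heq : (fun t : 𝕜 => E (x + t • EuclideanSpace.single j (1 : 𝕜))) =ᶠ[nhds 0]
      fun t => (x j + t) ^ n j * f (x + t • EuclideanSpace.single j (1 : 𝕜))
        * ∏ i ∈ Finset.univ.erase j, (x i) ^ (n i) := by
    filter_upwards [htend.eventually hE] with t ht
    rw [ht, ← Finset.mul_prod_erase _ _ (Finset.mem_univ j)]
    have hrest : ∏ i ∈ Finset.univ.erase j,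
        ((x + t • EuclideanSpace.single j (1 : 𝕜)) i) ^ (n i)
        = ∏ i ∈ Finset.univ.erase j, (x i) ^ (n i) := by
      refine Finset.prod_congr rfl fun i hi => ?_
      simp [Finset.ne_of_mem_erase hi]
    rw [hrest]
    simp
    ring
  simpa using hEl.unique (hprod.congr_of_eventuallyEq heq)

/-- The smallest base is at most the weighted geometric mean of all bases. -/
theorem exists_le_prod_pow_rpow {ι : Type*} [Fintype ι] {n : ι → ℕ} (hn : ∃ i, 1 ≤ n i)
    (a : ι → ℝ) (ha : ∀ i, 0 ≤ a i) :
    ∃ j, 1 ≤ n j ∧ a j ≤ (∏ i, a i ^ n i) ^ (1 / ((∑ i, n i : ℕ) : ℝ)) := by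
  obtain ⟨i₀, hi₀⟩ := hn
  obtain ⟨j, hj, hmin⟩ := Finset.exists_min_image (Finset.univ.filter fun i => 1 ≤ n i) a
    ⟨i₀, by simpa using hi₀⟩
  simp only [Finset.mem_filter, Finset.mem_univ, true_and] at hj hmin
  have hN : ∑ i, n i ≠ 0 := by
    have := Finset.single_le_sum (f := n) (fun i _ => Nat.zero_le _) (Finset.mem_univ j)
    omega
  refine ⟨j, hj, ?_⟩
  have hle : a j ^ (∑ i, n i) ≤ ∏ i, a i ^ n i := by
    rw [← Finset.prod_pow_eq_pow_sum]
    refine Finset.prod_le_prod (fun i _ => pow_nonneg (ha j) _) fun i _ => ?_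
    rcases Nat.eq_zero_or_pos (n i) with h | h
    · simp [h]
    · exact pow_le_pow_left₀ (ha j) (hmin i h) _
  calc a j = (a j ^ (∑ i, n i)) ^ (1 / ((∑ i, n i : ℕ) : ℝ)) := by
        rw [one_div, Real.pow_rpow_inv_natCast (ha j) hN]
    _ ≤ _ := Real.rpow_le_rpow (pow_nonneg (ha j) _) hle (by positivity)


/-- **Łojasiewicz gradient inequality for a `C¹` function with simple normal crossings.**
Let `d ≥ 2`, `𝕜 = ℝ` or `ℂ`, `U` an open neighborhood of the origin in `𝕜^d`, and
`E(x) = x₁^{n₁} ⋯ x_d^{n_d} f₀(x)` on `U` with nonnegative integers `nᵢ`, at least one `nᵢ ≥ 1`,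
and `f₀` of class `C¹` with `f₀(0) ≠ 0`. If `E'(0) = 0` then, with `N = n₁ + ⋯ + n_d`
(necessarily `N ≥ 2`) and `θ = 1 − 1/N ∈ [1/2,1)`, there are `C₀ ∈ (0,∞)` and `σ ∈ (0,1]`
with `B_σ ⊆ U` such that `‖E'(x)‖ ≥ C₀ · |E(x)|^θ` on `B_σ`. -/
theorem lojasiewicz_gradient_inequality_simple_normal_crossings
    (d : ℕ) (hd : 2 ≤ d) (𝕜 : Type) [RCLike 𝕜]
    (U : Set (EuclideanSpace 𝕜 (Fin d))) (hU : IsOpen U)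
    (hU0 : (0 : EuclideanSpace 𝕜 (Fin d)) ∈ U)
    (E f₀ : EuclideanSpace 𝕜 (Fin d) → 𝕜) (n : Fin d → ℕ)
    (hf₀ : ContDiffOn 𝕜 1 f₀ U) (hf₀0 : f₀ 0 ≠ 0)
    (hsnc : ∀ x ∈ U, E x = (∏ i, (x i) ^ (n i)) * f₀ x)
    (hn : ∃ i, 1 ≤ n i)
    (hcrit : fderiv 𝕜 E 0 = 0) :
    2 ≤ ∑ i, n i ∧
    (1 - 1 / ((∑ i, n i : ℕ) : ℝ)) ∈ Set.Ico (1/2 : ℝ) 1 ∧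
    ∃ C₀ : ℝ, 0 < C₀ ∧ ∃ σ ∈ Set.Ioc (0:ℝ) 1,
      Metric.ball (0 : EuclideanSpace 𝕜 (Fin d)) σ ⊆ U ∧
      ∀ x ∈ Metric.ball (0 : EuclideanSpace 𝕜 (Fin d)) σ,
        ‖fderiv 𝕜 E x‖ ≥ C₀ * ‖E x‖ ^ (1 - 1 / ((∑ i, n i : ℕ) : ℝ)) := by
  have hdiff : ∀ x ∈ U, DifferentiableAt 𝕜 f₀ x := fun x hx =>
    (hf₀.differentiableOn one_ne_zero).differentiableAt (hU.mem_nhds hx)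
  have hpartial : ∀ x ∈ U, ∀ j, fderiv 𝕜 E x (EuclideanSpace.single j 1) =
      (n j * (x j) ^ (n j - 1) * f₀ x
        + (x j) ^ (n j) * fderiv 𝕜 f₀ x (EuclideanSpace.single j 1))
        * ∏ i ∈ Finset.univ.erase j, (x i) ^ (n i) := fun x hx j =>
    fderiv_monomial_mul_apply_single
      (Filter.eventually_of_mem (hU.mem_nhds hx) hsnc) (hdiff x hx) j
  have hN : 2 ≤ ∑ i, n i := by
    by_contra! hlt
    obtain ⟨j, hj⟩ := hn
    have hsum := Finset.add_sum_erase Finset.univ n (Finset.mem_univ j)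
    have hj1 : n j = 1 := by omega
    have hrest : ∑ i ∈ Finset.univ.erase j, n i = 0 := by omega
    have hzero : ∀ i ∈ Finset.univ.erase j, n i = 0 := Finset.sum_eq_zero_iff.mp hrest
    have hprod : ∏ i ∈ Finset.univ.erase j,
        ((0 : EuclideanSpace 𝕜 (Fin d)) i) ^ (n i) = 1 :=
      Finset.prod_eq_one fun i hi => by rw [hzero i hi, pow_zero]
    have h := hpartial 0 hU0 j
    rw [hcrit, hprod, hj1] at h
    exact hf₀0 (by simpa using h.symm)
  set N := ∑ i, n i
  have hNR : (2 : ℝ) ≤ (N : ℝ) := by exact_mod_cast hN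
  have hinv : 1 / (N : ℝ) ≤ 1 / 2 := one_div_le_one_div_of_le two_pos hNR
  have hinv0 : 0 < 1 / (N : ℝ) := by positivity
  refine ⟨hN, ⟨by linarith, by linarith⟩, ?_⟩
  have hm : 0 < ‖f₀ 0‖ / 2 := by positivity
  set m := ‖f₀ 0‖ / 2 with hm_def
  set K := ‖fderiv 𝕜 f₀ 0‖ + 1 with hK_def
  have hK : 0 < K := by positivity
  have hev : ∀ᶠ x in nhds (0 : EuclideanSpace 𝕜 (Fin d)),
      x ∈ U ∧ m < ‖f₀ x‖ ∧ ‖fderiv 𝕜 f₀ x‖ < K := by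
    refine Filter.Eventually.and (hU.mem_nhds hU0) (.and ?_ ?_)
    · exact (hdiff 0 hU0).continuousAt.norm.eventually_const_lt (by linarith)
    · exact ((hf₀.continuousOn_fderiv_of_isOpen hU le_rfl).continuousAt
        (hU.mem_nhds hU0)).norm.eventually_lt_const (by linarith)
  obtain ⟨ε, hε, hball⟩ := Metric.eventually_nhds_iff_ball.mp hev
  refine ⟨m ^ (1 / (N : ℝ)) / 2, by positivity, min (min ε 1) (m / (2 * K)),
    ⟨by positivity, (min_le_left _ _).trans (min_le_right _ _)⟩, fun x hx => ?_, fun x hx => ?_⟩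
  · exact (hball x (Metric.ball_subset_ball ((min_le_left _ _).trans (min_le_left _ _)) hx)).1
  obtain ⟨hxU, hmx, hKx⟩ :=
    hball x (Metric.ball_subset_ball ((min_le_left _ _).trans (min_le_left _ _)) hx)
  have hxσ : ‖x‖ < m / (2 * K) := (mem_ball_zero_iff.mp hx).trans_le (min_le_right _ _)
  have hθ : 1 - 1 / (N : ℝ) ≠ 0 := by linarith
  by_cases hEx : E x = 0
  · rw [hEx, norm_zero, Real.zero_rpow hθ, mul_zero]
    exact norm_nonneg _
  obtain ⟨j, hj, hle⟩ := exists_le_prod_pow_rpow hn (fun i => ‖x i‖) fun i => norm_nonneg _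
  have hprodj := Finset.mul_prod_erase Finset.univ (fun i => x i ^ n i) (Finset.mem_univ j)
  have hxj : x j ≠ 0 := by
    intro h0
    apply hEx
    rw [hsnc x hxU, ← hprodj, h0, zero_pow (by omega), zero_mul, zero_mul]
  have hxj0 : 0 < ‖x j‖ := norm_pos_iff.mpr hxj
  have hnormE : ‖E x‖ = (∏ i, ‖x i‖ ^ n i) * ‖f₀ x‖ := by
    rw [hsnc x hxU, norm_mul, norm_prod]
    simp only [norm_pow]
  set P := ∏ i, ‖x i‖ ^ n i with hP_def
  have hP : 0 < P := by
    refine lt_of_le_of_ne (by positivity) fun h => hEx ?_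
    rw [← norm_eq_zero, hnormE, ← h, zero_mul]
  -- the gradient along the `j`-th coordinate, scaled by that coordinate
  have hscaled : x j * fderiv 𝕜 E x (EuclideanSpace.single j 1) =
      (∏ i, x i ^ n i) *
        (n j * f₀ x + x j * fderiv 𝕜 f₀ x (EuclideanSpace.single j 1)) := by
    rw [hpartial x hxU j, ← hprodj]
    obtain ⟨k, hk⟩ := Nat.exists_eq_add_of_le' hj
    rw [hk, Nat.add_sub_cancel]
    ring
  have hsingle : ‖EuclideanSpace.single j (1 : 𝕜)‖ = 1 := by simp
  have hgrad : ‖fderiv 𝕜 E x (EuclideanSpace.single j 1)‖ ≤ ‖fderiv 𝕜 E x‖ := by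
    simpa [hsingle] using (fderiv 𝕜 E x).le_opNorm (EuclideanSpace.single j 1)
  have hgrad₀ : ‖fderiv 𝕜 f₀ x (EuclideanSpace.single j 1)‖ ≤ K := by
    refine le_trans ?_ hKx.le
    simpa [hsingle] using (fderiv 𝕜 f₀ x).le_opNorm (EuclideanSpace.single j 1)
  have hsmall : ‖x j * fderiv 𝕜 f₀ x (EuclideanSpace.single j 1)‖ ≤ ‖f₀ x‖ / 2 := by
    rw [norm_mul]
    calc ‖x j‖ * ‖fderiv 𝕜 f₀ x (EuclideanSpace.single j 1)‖
        ≤ m / (2 * K) * K := by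
          gcongr
          exact (PiLp.norm_apply_le x j).trans hxσ.le
      _ = m / 2 := by field_simp
      _ ≤ ‖f₀ x‖ / 2 := by linarith
  have hbig : ‖f₀ x‖ ≤ ‖(n j : 𝕜) * f₀ x‖ := by
    rw [norm_mul, RCLike.norm_natCast]
    exact le_mul_of_one_le_left (norm_nonneg _) (by exact_mod_cast hj)
  have hfactor : ‖f₀ x‖ / 2 ≤
      ‖(n j : 𝕜) * f₀ x + x j * fderiv 𝕜 f₀ x (EuclideanSpace.single j 1)‖ := by
    have := norm_sub_le_norm_add ((n j : 𝕜) * f₀ x)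
      (x j * fderiv 𝕜 f₀ x (EuclideanSpace.single j 1))
    linarith
  have hlower : ‖E x‖ / 2 ≤ ‖x j‖ * ‖fderiv 𝕜 E x‖ := by
    calc ‖E x‖ / 2 = P * (‖f₀ x‖ / 2) := by rw [hnormE]; ring
      _ ≤ P * ‖(n j : 𝕜) * f₀ x + x j * fderiv 𝕜 f₀ x (EuclideanSpace.single j 1)‖ := by
          gcongr
      _ = ‖x j‖ * ‖fderiv 𝕜 E x (EuclideanSpace.single j 1)‖ := by
          rw [← norm_mul, hscaled, norm_mul, norm_prod]
          simp only [norm_pow, hP_def]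
      _ ≤ ‖x j‖ * ‖fderiv 𝕜 E x‖ := by gcongr
  have hPpos : 0 < P ^ (1 / (N : ℝ)) := Real.rpow_pos_of_pos hP _
  have hEpos : 0 < ‖E x‖ := norm_pos_iff.mpr hEx
  refine le_of_mul_le_mul_left ?_ hPpos
  calc P ^ (1 / (N : ℝ)) * (m ^ (1 / (N : ℝ)) / 2 * ‖E x‖ ^ (1 - 1 / (N : ℝ)))
      = (P * m) ^ (1 / (N : ℝ)) * ‖E x‖ ^ (1 - 1 / (N : ℝ)) / 2 := by
        rw [Real.mul_rpow hP.le hm.le]; ring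
    _ ≤ ‖E x‖ ^ (1 / (N : ℝ)) * ‖E x‖ ^ (1 - 1 / (N : ℝ)) / 2 := by
        rw [hnormE]
        gcongr
    _ = ‖E x‖ / 2 := by
        rw [← Real.rpow_add hEpos, add_sub_cancel, Real.rpow_one]
    _ ≤ ‖x j‖ * ‖fderiv 𝕜 E x‖ := hlower
    _ ≤ P ^ (1 / (N : ℝ)) * ‖fderiv 𝕜 E x‖ := by gcongr
end

section
/- Let d ≥ 2 be an integer, 𝕂 = ℝ or ℂ, U ⊆ 𝕂^d an open neighborhood of the origin, and f₀ : U → 𝕂 a C² function with f₀(x) ≠ 0 for all x ∈ U. (Case 1) If E(x) = f₀(x)·x₁², then there exists σ ∈ (0,1] with B_σ ⊆ U such that Crit E ∩ B_σ = {x ∈ B_σ : x₁ = 0}, and for every x ∈ Crit E ∩ B_σ the kernel of the Hessian E''(x), viewed as a linear operator 𝕂^d → (𝕂^d)^*, equals {v ∈ 𝕂^d : v₁ = 0}. (Case 2) If E(x) = f₀(x)·x₁x₂, then there exists σ ∈ (0,1] with B_σ ⊆ U such that Crit E ∩ B_σ = {x ∈ B_σ : x₁ = 0 and x₂ = 0},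 and for every x ∈ Crit E ∩ B_σ the kernel of E''(x) equals {v ∈ 𝕂^d : v₁ = 0 and v₂ = 0}. In particular, in both cases E is Morse–Bott on B_σ: its critical set there is a smooth submanifold whose tangent space at each critical point equals the kernel of the Hessian. -/
open Filter Topology

section ProductOfLinearForms

variable {𝕜 : Type*} [RCLike 𝕜] {V : Type*} [NormedAddCommGroup V] [NormedSpace 𝕜 V]
  {U : Set V} {f E : V → 𝕜} {l m : V →L[𝕜] 𝕜}

/-- The derivative of `f · l · m` for linear forms `l` and `m`. -/
lemma fderiv_mul_linear_mul_linear (hU : IsOpen U) (hf : ContDiffOn 𝕜 2 f U)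
    (hE : ∀ x ∈ U, E x = f x * l x * m x) {x : V} (hx : x ∈ U) :
    fderiv 𝕜 E x = (f x * l x) • m + (f x * m x) • l + (l x * m x) • fderiv 𝕜 f x := by
  have hfx : HasFDerivAt f (fderiv 𝕜 f x) x :=
    ((hf.contDiffAt (hU.mem_nhds hx)).differentiableAt (by norm_num)).hasFDerivAt
  have hEf : E =ᶠ[𝓝 x] fun y => f y * l y * m y :=
    Filter.eventually_of_mem (hU.mem_nhds hx) hE
  rw [hEf.fderiv_eq, ((hfx.fun_mul l.hasFDerivAt).fun_mul m.hasFDerivAt).fderiv]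
  ext v
  simp
  ring

lemma fderiv_mul_linear_mul_linear_eq_zero (hU : IsOpen U) (hf : ContDiffOn 𝕜 2 f U)
    (hE : ∀ x ∈ U, E x = f x * l x * m x) {x : V} (hx : x ∈ U) (hl : l x = 0) (hm : m x = 0) :
    fderiv 𝕜 E x = 0 := by
  ext v
  simp [fderiv_mul_linear_mul_linear hU hf hE hx, hl, hm]

/-- The Hessian of `f · l · m` at a common zero of the linear forms `l` and `m`. -/
lemma fderiv_fderiv_mul_linear_mul_linear (hU : IsOpen U) (hf : ContDiffOn 𝕜 2 f U)
    (hE : ∀ x ∈ U, E x = f x * l x * m x) {x : V} (hx : x ∈ U) (hl : l x = 0) (hm : m x = 0)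
    (v : V) :
    fderiv 𝕜 (fderiv 𝕜 E) x v = (f x * l v) • m + (f x * m v) • l := by
  have hfC := hf.contDiffAt (hU.mem_nhds hx)
  have hfx : HasFDerivAt f (fderiv 𝕜 f x) x :=
    (hfC.differentiableAt (by norm_num)).hasFDerivAt
  have hfx' : HasFDerivAt (fderiv 𝕜 f) (fderiv 𝕜 (fderiv 𝕜 f) x) x :=
    ((hfC.fderiv_right (m := 1) (by norm_num)).differentiableAt (by norm_num)).hasFDerivAt
  have hEf : fderiv 𝕜 E =ᶠ[𝓝 x] fun y =>
      (f y * l y) • m + (f y * m y) • l + (l y * m y) • fderiv 𝕜 f y :=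
    Filter.eventually_of_mem (hU.mem_nhds hx)
      fun y hy => fderiv_mul_linear_mul_linear hU hf hE hy
  rw [hEf.fderiv_eq, ((((hfx.fun_mul l.hasFDerivAt).smul_const m).fun_add
    ((hfx.fun_mul m.hasFDerivAt).smul_const l)).fun_add
    ((l.hasFDerivAt.fun_mul m.hasFDerivAt).fun_smul hfx')).fderiv]
  ext w
  simp [hl, hm]

/-- Near the origin, `f` dominates the first-order correction `l · ∂f`. -/
lemma eventually_mul_add_linear_mul_fderiv_ne_zero (hU : IsOpen U) (hU0 : (0 : V) ∈ U)
    (hf : ContDiffOn 𝕜 2 f U) (hf0 : f 0 ≠ 0) {c : 𝕜} (hc : c ≠ 0) (l : V →L[𝕜] 𝕜) (w : V) :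
    ∀ᶠ x in 𝓝 (0 : V), c * f x + l x * fderiv 𝕜 f x w ≠ 0 := by
  have hfC := hf.contDiffAt (hU.mem_nhds hU0)
  have hf' : ContinuousAt (fun x => fderiv 𝕜 f x w) 0 :=
    (hfC.fderiv_right (m := 1) (by norm_num)).continuousAt.clm_apply continuousAt_const
  have hcont : ContinuousAt (fun x => c * f x + l x * fderiv 𝕜 f x w) 0 :=
    (continuousAt_const.mul hfC.continuousAt).add (l.continuous.continuousAt.mul hf')
  exact hcont.eventually_ne (by simp [hc, hf0])

end ProductOfLinearForms

lemma exists_ball_subset_of_eventually {V : Type*} [SeminormedAddCommGroup V] {p : V → Prop}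
    (h : ∀ᶠ x in 𝓝 (0 : V), p x) :
    ∃ σ ∈ Set.Ioc (0 : ℝ) 1, ∀ x ∈ Metric.ball (0 : V) σ, p x := by
  obtain ⟨ε, hε, hp⟩ := Metric.eventually_nhds_iff_ball.1 h
  exact ⟨min ε 1, ⟨lt_min hε one_pos, min_le_right _ _⟩,
    fun x hx => hp x (Metric.ball_subset_ball (min_le_left _ _) hx)⟩

section MorseBott

variable {𝕜 : Type*} [RCLike 𝕜] {V : Type*} [NormedAddCommGroup V] [NormedSpace 𝕜 V]
  {U : Set V} {f E : V → 𝕜} {l m : V →L[𝕜] 𝕜}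

theorem exists_ball_morseBott_mul_linear_sq (hU : IsOpen U) (hU0 : (0 : V) ∈ U)
    (hf : ContDiffOn 𝕜 2 f U) (hfne : ∀ x ∈ U, f x ≠ 0) {a : V} (hla : l a = 1)
    (hE : ∀ x ∈ U, E x = f x * l x ^ 2) :
    ∃ σ ∈ Set.Ioc (0 : ℝ) 1, Metric.ball (0 : V) σ ⊆ U ∧
      ({x ∈ U | fderiv 𝕜 E x = 0} ∩ Metric.ball 0 σ = {x ∈ Metric.ball (0 : V) σ | l x = 0}) ∧
      ∀ x ∈ {x ∈ U | fderiv 𝕜 E x = 0} ∩ Metric.ball 0 σ,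
        {v : V | fderiv 𝕜 (fderiv 𝕜 E) x v = 0} = {v : V | l v = 0} := by
  replace hE : ∀ x ∈ U, E x = f x * l x * l x := fun x hx => by rw [hE x hx]; ring
  obtain ⟨σ, hσ, hball⟩ := exists_ball_subset_of_eventually ((hU.eventually_mem hU0).and
    (eventually_mul_add_linear_mul_fderiv_ne_zero hU hU0 hf (hfne 0 hU0) two_ne_zero l a))
  have hcrit : ∀ x ∈ Metric.ball (0 : V) σ, fderiv 𝕜 E x = 0 → l x = 0 := by
    intro x hx h
    obtain ⟨hxU, hne⟩ := hball x hx
    have ha := congrArg (fun φ : V →L[𝕜] 𝕜 => φ a) h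
    simp only [fderiv_mul_linear_mul_linear hU hf hE hxU, add_apply,
      smul_apply, zero_apply, smul_eq_mul, hla] at ha
    have : l x * (2 * f x + l x * fderiv 𝕜 f x a) = 0 := by linear_combination ha
    exact (mul_eq_zero.1 this).resolve_right hne
  refine ⟨σ, hσ, fun x hx => (hball x hx).1, ?_, ?_⟩
  · ext x
    constructor
    · rintro ⟨⟨-, h⟩, hx⟩
      exact ⟨hx, hcrit x hx h⟩
    · rintro ⟨hx, h⟩
      have hxU := (hball x hx).1
      exact ⟨⟨hxU, fderiv_mul_linear_mul_linear_eq_zero hU hf hE hxU h h⟩, hx⟩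
  · rintro x ⟨⟨hxU, h⟩, hx⟩
    have hl := hcrit x hx h
    ext v
    rw [Set.mem_ofPred_eq, Set.mem_ofPred_eq,
      fderiv_fderiv_mul_linear_mul_linear hU hf hE hxU hl hl]
    refine ⟨fun h => ?_, fun h => by ext w; simp [h]⟩
    have ha := congrArg (fun φ : V →L[𝕜] 𝕜 => φ a) h
    simp only [add_apply, smul_apply,
      zero_apply, smul_eq_mul, hla] at ha
    have : 2 * f x * l v = 0 := by linear_combination ha
    exact (mul_eq_zero.1 this).resolve_left (mul_ne_zero two_ne_zero (hfne x hxU))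

theorem exists_ball_morseBott_mul_linear_mul_linear (hU : IsOpen U) (hU0 : (0 : V) ∈ U)
    (hf : ContDiffOn 𝕜 2 f U) (hfne : ∀ x ∈ U, f x ≠ 0) {a b : V}
    (hla : l a = 1) (hma : m a = 0) (hlb : l b = 0) (hmb : m b = 1)
    (hE : ∀ x ∈ U, E x = f x * l x * m x) :
    ∃ σ ∈ Set.Ioc (0 : ℝ) 1, Metric.ball (0 : V) σ ⊆ U ∧
      ({x ∈ U | fderiv 𝕜 E x = 0} ∩ Metric.ball 0 σ =
        {x ∈ Metric.ball (0 : V) σ | l x = 0 ∧ m x = 0}) ∧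
      ∀ x ∈ {x ∈ U | fderiv 𝕜 E x = 0} ∩ Metric.ball 0 σ,
        {v : V | fderiv 𝕜 (fderiv 𝕜 E) x v = 0} = {v : V | l v = 0 ∧ m v = 0} := by
  obtain ⟨σ, hσ, hball⟩ := exists_ball_subset_of_eventually ((hU.eventually_mem hU0).and
    ((eventually_mul_add_linear_mul_fderiv_ne_zero hU hU0 hf (hfne 0 hU0) one_ne_zero l a).and
      (eventually_mul_add_linear_mul_fderiv_ne_zero hU hU0 hf (hfne 0 hU0) one_ne_zero m b)))
  have hcrit : ∀ x ∈ Metric.ball (0 : V) σ, fderiv 𝕜 E x = 0 → l x = 0 ∧ m x = 0 := by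
    intro x hx h
    obtain ⟨hxU, hnea, hneb⟩ := hball x hx
    have ha := congrArg (fun φ : V →L[𝕜] 𝕜 => φ a) h
    have hb := congrArg (fun φ : V →L[𝕜] 𝕜 => φ b) h
    simp only [fderiv_mul_linear_mul_linear hU hf hE hxU, add_apply,
      smul_apply, zero_apply, smul_eq_mul, hla, hma, hlb, hmb] at ha hb
    have hm : m x * (1 * f x + l x * fderiv 𝕜 f x a) = 0 := by linear_combination ha
    have hl : l x * (1 * f x + m x * fderiv 𝕜 f x b) = 0 := by linear_combination hb
    exact ⟨(mul_eq_zero.1 hl).resolve_right hneb, (mul_eq_zero.1 hm).resolve_right hnea⟩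
  refine ⟨σ, hσ, fun x hx => (hball x hx).1, ?_, ?_⟩
  · ext x
    constructor
    · rintro ⟨⟨-, h⟩, hx⟩
      exact ⟨hx, hcrit x hx h⟩
    · rintro ⟨hx, hl, hm⟩
      have hxU := (hball x hx).1
      exact ⟨⟨hxU, fderiv_mul_linear_mul_linear_eq_zero hU hf hE hxU hl hm⟩, hx⟩
  · rintro x ⟨⟨hxU, h⟩, hx⟩
    obtain ⟨hl, hm⟩ := hcrit x hx h
    ext v
    rw [Set.mem_ofPred_eq, Set.mem_ofPred_eq,
      fderiv_fderiv_mul_linear_mul_linear hU hf hE hxU hl hm]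
    refine ⟨fun h => ?_, fun h => by ext w; simp [h.1, h.2]⟩
    have ha := congrArg (fun φ : V →L[𝕜] 𝕜 => φ a) h
    have hb := congrArg (fun φ : V →L[𝕜] 𝕜 => φ b) h
    simp only [add_apply, smul_apply,
      zero_apply, smul_eq_mul, hla, hma, hlb, hmb, mul_zero, mul_one,
      zero_add, add_zero] at ha hb
    exact ⟨(mul_eq_zero.1 hb).resolve_left (hfne x hxU),
      (mul_eq_zero.1 ha).resolve_left (hfne x hxU)⟩

end MorseBott


/-- If `f₀` is `C²` and nonvanishing on a neighborhood `U` of the origin in `𝕜^d` (`d ≥ 2`),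
then: (Case 1) for `E(x) = f₀(x)·x₁²` there is `σ ∈ (0,1]` with `B_σ ⊆ U` such that
`Crit E ∩ B_σ = {x ∈ B_σ : x₁ = 0}` and for every such critical point the kernel of the
Hessian `E''(x) : 𝕜^d → (𝕜^d)^*` equals `{v : v₁ = 0}`; (Case 2) for `E(x) = f₀(x)·x₁x₂`
there is `σ ∈ (0,1]` with `B_σ ⊆ U` such that `Crit E ∩ B_σ = {x ∈ B_σ : x₁ = 0 ∧ x₂ = 0}`
and the kernel of `E''(x)` equals `{v : v₁ = 0 ∧ v₂ = 0}`. In particular `E` is Morse–Bott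
on `B_σ` in both cases. -/
theorem morse_bott_for_optimal_normal_crossings
    (d : ℕ) (hd : 2 ≤ d) (𝕜 : Type) [RCLike 𝕜]
    (U : Set (EuclideanSpace 𝕜 (Fin d))) (hU : IsOpen U)
    (hU0 : (0 : EuclideanSpace 𝕜 (Fin d)) ∈ U)
    (f₀ : EuclideanSpace 𝕜 (Fin d) → 𝕜)
    (hf₀ : ContDiffOn 𝕜 2 f₀ U) (hf₀ne : ∀ x ∈ U, f₀ x ≠ 0)
    (E : EuclideanSpace 𝕜 (Fin d) → 𝕜) :
    -- Case 1: `E(x) = f₀(x) · x₁²`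
    ((∀ x ∈ U, E x = f₀ x * (x ⟨0, by omega⟩) ^ 2) →
      ∃ σ ∈ Set.Ioc (0:ℝ) 1, Metric.ball (0 : EuclideanSpace 𝕜 (Fin d)) σ ⊆ U ∧
        ({x ∈ U | fderiv 𝕜 E x = 0} ∩ Metric.ball 0 σ
            = {x ∈ Metric.ball (0 : EuclideanSpace 𝕜 (Fin d)) σ | x ⟨0, by omega⟩ = 0}) ∧
        ∀ x ∈ {x ∈ U | fderiv 𝕜 E x = 0} ∩ Metric.ball 0 σ,
          {v : EuclideanSpace 𝕜 (Fin d) | fderiv 𝕜 (fderiv 𝕜 E) x v = 0}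
            = {v : EuclideanSpace 𝕜 (Fin d) | v ⟨0, by omega⟩ = 0}) ∧
    -- Case 2: `E(x) = f₀(x) · x₁ · x₂`
    ((∀ x ∈ U, E x = f₀ x * (x ⟨0, by omega⟩) * (x ⟨1, by omega⟩)) →
      ∃ σ ∈ Set.Ioc (0:ℝ) 1, Metric.ball (0 : EuclideanSpace 𝕜 (Fin d)) σ ⊆ U ∧
        ({x ∈ U | fderiv 𝕜 E x = 0} ∩ Metric.ball 0 σ
            = {x ∈ Metric.ball (0 : EuclideanSpace 𝕜 (Fin d)) σ |
                x ⟨0, by omega⟩ = 0 ∧ x ⟨1, by omega⟩ = 0}) ∧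
        ∀ x ∈ {x ∈ U | fderiv 𝕜 E x = 0} ∩ Metric.ball 0 σ,
          {v : EuclideanSpace 𝕜 (Fin d) | fderiv 𝕜 (fderiv 𝕜 E) x v = 0}
            = {v : EuclideanSpace 𝕜 (Fin d) |
                v ⟨0, by omega⟩ = 0 ∧ v ⟨1, by omega⟩ = 0}) := by
  constructor
  · exact exists_ball_morseBott_mul_linear_sq (l := EuclideanSpace.proj ⟨0, by omega⟩)
      (a := EuclideanSpace.single ⟨0, by omega⟩ 1) hU hU0 hf₀ hf₀ne (by simp)
  · exact exists_ball_morseBott_mul_linear_mul_linear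
      (l := EuclideanSpace.proj ⟨0, by omega⟩) (m := EuclideanSpace.proj ⟨1, by omega⟩)
      (a := EuclideanSpace.single ⟨0, by omega⟩ 1) (b := EuclideanSpace.single ⟨1, by omega⟩ 1)
      hU hU0 hf₀ hf₀ne (by simp) (by simp [Fin.ext_iff]) (by simp [Fin.ext_iff])
      (by simp)
end

section
/- Let d ≥ 1 be an integer, U ⊆ ℝ^d an open neighborhood of the origin, and E : U → ℝ a C¹ function with E(0) = 0, E'(0) = 0, and E ≥ 0 on U. Suppose E satisfies the Łojasiewicz gradient inequality near the origin with constants C ∈ (0,∞), σ ∈ (0,1], θ ∈ [1/2,1): B_σ ⊆ U and ‖E'(x)‖ ≥ C·E(x)^θ for all x ∈ B_σ. Then, with α = 1/(1−θ) ∈ [2,∞), there exist constants C₁ ∈ (0,∞) and δ ∈ (0, σ/4] such that E(x) ≥ C₁ · dist(x, B_σ ∩ Crit E)^α for all x ∈ B_δ. If in addition B_σ ∩ Crit E ⊆ B_σ ∩ Zero E, then also E(x) ≥ C₁ · dist(x, B_σ ∩ Zero E)^α for all x ∈ B_δ. -/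
open Metric Set Filter Topology in
/-- If `f` decreases near `y` at a rate of at most `c`, then its derivative at `y` has norm at
most `c`. -/
theorem HasFDerivAt.opNorm_le_of_eventually_sub_le {V : Type*} [NormedAddCommGroup V]
    [NormedSpace ℝ V] {f : V → ℝ} {L : V →L[ℝ] ℝ} {y : V} {c : ℝ} (hc : 0 ≤ c)
    (hf : HasFDerivAt f L y) (h : ∀ᶠ z in 𝓝 y, f y - c * ‖z - y‖ ≤ f z) : ‖L‖ ≤ c := by
  have lower : ∀ v, -(c * ‖v‖) ≤ L v := by
    intro v
    have hd : HasDerivAt (fun t : ℝ => f (y + t • v)) (L v) 0 := hf.hasLineDerivAt v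
    have hcont : Tendsto (fun t : ℝ => y + t • v) (𝓝[>] 0) (𝓝 y) := by
      have : Continuous fun t : ℝ => y + t • v := by fun_prop
      simpa using (this.tendsto 0).mono_left nhdsWithin_le_nhds
    refine ge_of_tendsto hd.tendsto_slope_zero_right ?_
    filter_upwards [hcont.eventually h, self_mem_nhdsWithin] with t ht (ht0 : 0 < t)
    simp only [add_sub_cancel_left, norm_smul, Real.norm_eq_abs, _root_.abs_of_pos ht0] at ht
    simp only [zero_add, zero_smul, add_zero, smul_eq_mul]
    rw [inv_mul_eq_div, le_div_iff₀ ht0]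
    linarith
  refine L.opNorm_le_bound hc fun v => ?_
  rw [Real.norm_eq_abs, abs_le]
  refine ⟨lower v, ?_⟩
  have := lower (-v)
  rw [norm_neg, map_neg] at this
  linarith

open Metric Set Filter Topology in
/-- A nonnegative continuous function on a closed ball whose value at the centre is less than `c`
times the radius admits an interior point near which it decreases at a rate of at most `c`. -/
theorem exists_mem_ball_eventually_sub_le {V : Type*} [NormedAddCommGroup V] [ProperSpace V]
    {f : V → ℝ} {x : V} {r c : ℝ} (hr : 0 < r) (hc : 0 ≤ c) (hf : ContinuousOn f (closedBall x r))
    (hnn : ∀ z ∈ closedBall x r, 0 ≤ f z) (hx : f x < c * r) :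
    ∃ y ∈ ball x r, ∀ᶠ z in 𝓝 y, f y - c * ‖z - y‖ ≤ f z := by
  obtain ⟨y, hy, hmin⟩ := (isCompact_closedBall x r).exists_isMinOn
    ⟨x, mem_closedBall_self hr.le⟩
    (hf.add (f := f) (g := fun z => c * ‖z - x‖) (by fun_prop))
  have hyx : f y + c * ‖y - x‖ ≤ f x := by
    simpa using hmin (mem_closedBall_self hr.le)
  have hyr : y ∈ ball x r := by
    rw [mem_ball, dist_eq_norm]
    exact lt_of_mul_lt_mul_left (by linarith [hnn y hy]) hc
  refine ⟨y, hyr, ?_⟩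
  filter_upwards [isOpen_ball.mem_nhds hyr] with z hz
  have h1 : f y + c * ‖y - x‖ ≤ f z + c * ‖z - x‖ := hmin (ball_subset_closedBall hz)
  have h2 : c * ‖z - x‖ ≤ c * (‖z - y‖ + ‖y - x‖) :=
    mul_le_mul_of_nonneg_left (norm_sub_le_norm_sub_add_norm_sub z y x) hc
  linarith


/-- **Łojasiewicz distance inequalities.** Let `E : U → ℝ` be `C¹` on a neighborhood of the
origin in `ℝ^d`, with `E(0) = 0`, `E'(0) = 0`, `E ≥ 0` on `U`, satisfying the Łojasiewicz
gradient inequality on `B_σ ⊆ U` with constants `C > 0`, `σ ∈ (0,1]`, `θ ∈ [1/2,1)`. Then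
with `α = 1/(1−θ)` there are `C₁ > 0` and `δ ∈ (0,σ/4]` with
`E(x) ≥ C₁ · dist(x, B_σ ∩ Crit E)^α` on `B_δ`; if moreover `B_σ ∩ Crit E ⊆ B_σ ∩ Zero E`,
then also `E(x) ≥ C₁ · dist(x, B_σ ∩ Zero E)^α` on `B_δ`. -/
theorem lojasiewicz_distance_inequalities
    (d : ℕ) (hd : 1 ≤ d)
    (U : Set (EuclideanSpace ℝ (Fin d))) (hU : IsOpen U)
    (hU0 : (0 : EuclideanSpace ℝ (Fin d)) ∈ U)
    (E : EuclideanSpace ℝ (Fin d) → ℝ) (hE : ContDiffOn ℝ 1 E U)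
    (hE0 : E 0 = 0) (hcrit : fderiv ℝ E 0 = 0) (hnn : ∀ x ∈ U, 0 ≤ E x)
    (C σ θ : ℝ) (hC : 0 < C) (hσ : σ ∈ Set.Ioc (0:ℝ) 1) (hθ : θ ∈ Set.Ico (1/2 : ℝ) 1)
    (hball : Metric.ball (0 : EuclideanSpace ℝ (Fin d)) σ ⊆ U)
    (hLoj : ∀ x ∈ Metric.ball (0 : EuclideanSpace ℝ (Fin d)) σ,
      ‖fderiv ℝ E x‖ ≥ C * (E x) ^ θ) :
    ∃ C₁ : ℝ, 0 < C₁ ∧ ∃ δ ∈ Set.Ioc (0:ℝ) (σ/4),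
      (∀ x ∈ Metric.ball (0 : EuclideanSpace ℝ (Fin d)) δ,
        E x ≥ C₁ * (Metric.infDist x
          (Metric.ball (0 : EuclideanSpace ℝ (Fin d)) σ ∩
            {y ∈ U | fderiv ℝ E y = 0})) ^ (1/(1-θ))) ∧
      ((Metric.ball (0 : EuclideanSpace ℝ (Fin d)) σ ∩ {y ∈ U | fderiv ℝ E y = 0}
          ⊆ Metric.ball (0 : EuclideanSpace ℝ (Fin d)) σ ∩ {y ∈ U | E y = 0}) →
        ∀ x ∈ Metric.ball (0 : EuclideanSpace ℝ (Fin d)) δ,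
          E x ≥ C₁ * (Metric.infDist x
            (Metric.ball (0 : EuclideanSpace ℝ (Fin d)) σ ∩
              {y ∈ U | E y = 0})) ^ (1/(1-θ))) := by
  obtain ⟨hσ0, -⟩ := hσ
  obtain ⟨hθ0, hθ1⟩ := hθ
  have hθ : 0 < 1 - θ := by linarith
  have hdiff : ∀ y ∈ U, DifferentiableAt ℝ E y := fun y hy =>
    (hE.differentiableOn one_ne_zero).differentiableAt (hU.mem_nhds hy)
  have zero_crit : ∀ y ∈ U, E y = 0 → fderiv ℝ E y = 0 := by
    intro y hy hy0
    refine IsLocalMin.fderiv_eq_zero ?_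
    filter_upwards [hU.mem_nhds hy] with z hz
    simpa [hy0] using hnn z hz
  set S := Metric.ball (0 : EuclideanSpace ℝ (Fin d)) σ ∩ {y ∈ U | fderiv ℝ E y = 0} with hS
  have h0S : (0 : EuclideanSpace ℝ (Fin d)) ∈ S := ⟨Metric.mem_ball_self hσ0, hU0, hcrit⟩
  obtain ⟨c, hc, hcC⟩ : ∃ c, 0 < c ∧ c < (1 - θ) * C := exists_between (mul_pos hθ hC)
  have key : ∀ x ∈ Metric.ball (0 : EuclideanSpace ℝ (Fin d)) (σ / 4),
      c * Metric.infDist x S ≤ E x ^ (1 - θ) := by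
    intro x hx
    by_contra! hlt
    have hxσ : ‖x‖ < σ / 4 := by simpa using hx
    have hrx : Metric.infDist x S ≤ ‖x‖ := by
      simpa using Metric.infDist_le_dist_of_mem (x := x) h0S
    set r := Metric.infDist x S with hr
    have hsub : Metric.closedBall x r ⊆ Metric.ball 0 σ :=
      Metric.closedBall_subset_ball' (by rw [dist_zero_right]; linarith)
    have hxU : x ∈ U := hball (by rw [mem_ball_zero_iff]; linarith)
    have hr0 : 0 < r :=
      pos_of_mul_pos_right ((Real.rpow_nonneg (hnn x hxU) _).trans_lt hlt) hc.le
    obtain ⟨y, hy, hloc⟩ := exists_mem_ball_eventually_sub_le (f := fun z => E z ^ (1 - θ))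
      hr0 hc.le
      ((hE.continuousOn.mono (hsub.trans hball)).rpow_const fun _ _ => Or.inr hθ.le)
      (fun z hz => Real.rpow_nonneg (hnn z (hball (hsub hz))) _) hlt
    have hyσ := hsub (Metric.ball_subset_closedBall hy)
    have hyU := hball hyσ
    have hyS : y ∉ S := fun h =>
      (Metric.infDist_le_dist_of_mem h).not_gt (by rw [dist_comm]; exact hy)
    have hEy : 0 < E y := (hnn y hyU).lt_of_ne' fun h => hyS ⟨hyσ, hyU, zero_crit y hyU h⟩
    have hle := ((hdiff y hyU).hasFDerivAt.rpow_const (p := 1 - θ)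
      (Or.inl hEy.ne')).opNorm_le_of_eventually_sub_le hc.le hloc
    have hpos : 0 < E y ^ (1 - θ - 1) := Real.rpow_pos_of_pos hEy _
    rw [norm_smul, Real.norm_of_nonneg (mul_pos hθ hpos).le] at hle
    have hmul : E y ^ (1 - θ - 1) * E y ^ θ = 1 := by
      rw [← Real.rpow_add hEy]
      simp
    have := mul_le_mul_of_nonneg_left (hLoj y hyσ) (mul_pos hθ hpos).le
    have heq : (1 - θ) * E y ^ (1 - θ - 1) * (C * E y ^ θ) = (1 - θ) * C := by
      linear_combination (1 - θ) * C * hmul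
    linarith
  have main : ∀ x ∈ Metric.ball (0 : EuclideanSpace ℝ (Fin d)) (σ / 4),
      E x ≥ c ^ (1 / (1 - θ)) * Metric.infDist x S ^ (1 / (1 - θ)) := by
    intro x hx
    have hxU : x ∈ U := hball (Metric.ball_subset_ball (by linarith) hx)
    rw [← Real.mul_rpow hc.le Metric.infDist_nonneg]
    calc _ ≤ (E x ^ (1 - θ)) ^ (1 / (1 - θ)) :=
          Real.rpow_le_rpow (mul_nonneg hc.le Metric.infDist_nonneg) (key x hx) (by positivity)
      _ = E x := by
          rw [one_div, Real.rpow_rpow_inv (hnn x hxU) hθ.ne']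
  refine ⟨c ^ (1 / (1 - θ)), Real.rpow_pos_of_pos hc _, σ / 4, ⟨by linarith, le_rfl⟩, main, ?_⟩
  intro hsub
  rwa [← hsub.antisymm (Set.inter_subset_inter_right _
    fun y hy => ⟨hy.1, zero_crit y hy.1 hy.2⟩)]
end

section
/- Let d ≥ 1 be an integer, U ⊆ ℝ^d an open neighborhood of the origin, and E : U → ℝ a C¹ function with E(0) = 0. Suppose the function E² satisfies the Łojasiewicz gradient inequality near the origin with constants C ∈ (0,∞), σ ∈ (0,1], θ ∈ [1/2,1): B_σ ⊆ U and ‖(E²)'(x)‖ ≥ C·(E(x)²)^θ for all x ∈ B_σ, and suppose B_σ ∩ Crit(E²) ⊆ B_σ ∩ Zero E. Then, with β = 1/(2(1−θ)) ∈ [1,∞), there exist constants C₂ ∈ (0,∞) and δ ∈ (0, σ/4] such that |E(x)| ≥ C₂ · dist(x, B_σ ∩ Zero E)^β for all x ∈ B_δ. -/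
open Filter Topology in
/-- If `f` decreases at rate at most `c` away from `x`, then its derivative at `x` has norm at
most `c`. -/
lemma norm_fderiv_le_of_eventually_sub_le {V : Type*} [NormedAddCommGroup V] [NormedSpace ℝ V]
    {f : V → ℝ} {f' : V →L[ℝ] ℝ} {x : V} {c : ℝ} (hc : 0 ≤ c) (hf : HasFDerivAt f f' x)
    (h : ∀ᶠ z in 𝓝 x, f x ≤ f z + c * ‖z - x‖) : ‖f'‖ ≤ c := by
  refine le_of_forall_pos_le_add fun ε hε => ?_
  have hlow : ∀ᶠ w in 𝓝 (0 : V), -f' w ≤ (c + ε) * ‖w‖ := by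
    have h1 : Tendsto (fun w : V => x + w) (𝓝 0) (𝓝 x) := by
      simpa using (continuous_const_add x).tendsto 0
    have h2 := (hasFDerivAt_iff_isLittleO_nhds_zero.1 hf).def hε
    filter_upwards [h1.eventually h, h2] with w hw1 hw2
    rw [add_sub_cancel_left] at hw1
    rw [Real.norm_eq_abs] at hw2
    linarith [(abs_le.1 hw2).2]
  have hneg : Tendsto (fun w : V => -w) (𝓝 0) (𝓝 0) := by
    simpa using (continuous_neg : Continuous fun w : V => -w).tendsto 0
  refine ContinuousLinearMap.opNorm_le_of_nhds_zero (by positivity) ?_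
  filter_upwards [hlow, hneg.eventually hlow] with w h1 h2
  rw [map_neg, neg_neg, norm_neg] at h2
  exact abs_le.2 ⟨by linarith, h2⟩

open Metric in
/-- If a nonnegative function `G` has slope larger than `c` wherever it is positive on the ball of
radius `infDist x Z` about `x`, and is positive there off `Z`, then `c * infDist x Z ≤ G x`. -/
lemma mul_infDist_le_of_lt_norm_fderiv {V : Type*} [NormedAddCommGroup V] [NormedSpace ℝ V]
    [ProperSpace V] {G : V → ℝ} {G' : V → V →L[ℝ] ℝ} {Z : Set V} {x : V} {c : ℝ} (hc : 0 < c)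
    (hcont : ContinuousOn G (closedBall x (infDist x Z)))
    (hnonneg : ∀ y ∈ closedBall x (infDist x Z), 0 ≤ G y)
    (hder : ∀ y ∈ ball x (infDist x Z), y ∉ Z → HasFDerivAt G (G' y) y ∧ c < ‖G' y‖) :
    c * infDist x Z ≤ G x := by
  by_contra! hlt
  set R := infDist x Z
  have hxK : x ∈ closedBall x R := mem_closedBall_self infDist_nonneg
  obtain ⟨y, hyK, hy⟩ := (isCompact_closedBall x R).exists_isMinOn ⟨x, hxK⟩
    (f := fun y => G y + c * ‖y - x‖) (hcont.add (by fun_prop))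
  have hmin : ∀ z ∈ closedBall x R, G y + c * ‖y - x‖ ≤ G z + c * ‖z - x‖ := fun z hz => hy hz
  have hyx := hmin x hxK
  have hyR : dist y x < R := by
    rw [sub_self, norm_zero, mul_zero, add_zero] at hyx
    rw [dist_eq_norm]
    exact lt_of_mul_lt_mul_left (by linarith [hnonneg y hyK]) hc.le
  have hyZ : y ∉ Z := fun hyZ => by
    have := infDist_le_dist_of_mem (x := x) hyZ
    rw [dist_comm] at this
    linarith
  obtain ⟨hd, hn⟩ := hder y hyR hyZ
  refine absurd (norm_fderiv_le_of_eventually_sub_le hc.le hd ?_) hn.not_ge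
  filter_upwards [isOpen_ball.mem_nhds (mem_ball.2 hyR)] with z hz
  have h1 := hmin z (ball_subset_closedBall hz)
  have h2 : ‖z - x‖ ≤ ‖z - y‖ + ‖y - x‖ := norm_sub_le_norm_sub_add_norm_sub z y x
  nlinarith [mul_le_mul_of_nonneg_left h2 hc.le]

/-- **Łojasiewicz distance inequality for the zero set.** Let `E : U → ℝ` be `C¹` on a
neighborhood of the origin in `ℝ^d` with `E(0) = 0`. If `E²` satisfies the Łojasiewicz
gradient inequality `‖(E²)'(x)‖ ≥ C·(E(x)²)^θ` on `B_σ ⊆ U` with `C > 0`, `σ ∈ (0,1]`,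
`θ ∈ [1/2,1)`, and `B_σ ∩ Crit(E²) ⊆ B_σ ∩ Zero E`, then with `β = 1/(2(1−θ))` there are
`C₂ > 0` and `δ ∈ (0,σ/4]` with `|E(x)| ≥ C₂ · dist(x, B_σ ∩ Zero E)^β` on `B_δ`. -/
theorem lojasiewicz_distance_inequality_zero_set
    (d : ℕ) (hd : 1 ≤ d)
    (U : Set (EuclideanSpace ℝ (Fin d))) (hU : IsOpen U)
    (hU0 : (0 : EuclideanSpace ℝ (Fin d)) ∈ U)
    (E : EuclideanSpace ℝ (Fin d) → ℝ) (hE : ContDiffOn ℝ 1 E U) (hE0 : E 0 = 0)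
    (C σ θ : ℝ) (hC : 0 < C) (hσ : σ ∈ Set.Ioc (0:ℝ) 1) (hθ : θ ∈ Set.Ico (1/2 : ℝ) 1)
    (hball : Metric.ball (0 : EuclideanSpace ℝ (Fin d)) σ ⊆ U)
    (hLoj : ∀ x ∈ Metric.ball (0 : EuclideanSpace ℝ (Fin d)) σ,
      ‖fderiv ℝ (fun y => (E y) ^ 2) x‖ ≥ C * ((E x) ^ 2) ^ θ)
    (hsub : Metric.ball (0 : EuclideanSpace ℝ (Fin d)) σ ∩
        {y ∈ U | fderiv ℝ (fun z => (E z) ^ 2) y = 0}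
      ⊆ Metric.ball (0 : EuclideanSpace ℝ (Fin d)) σ ∩ {y ∈ U | E y = 0}) :
    ∃ C₂ : ℝ, 0 < C₂ ∧ ∃ δ ∈ Set.Ioc (0:ℝ) (σ/4),
      ∀ x ∈ Metric.ball (0 : EuclideanSpace ℝ (Fin d)) δ,
        |E x| ≥ C₂ * (Metric.infDist x
          (Metric.ball (0 : EuclideanSpace ℝ (Fin d)) σ ∩
            {y ∈ U | E y = 0})) ^ (1/(2*(1-θ))) := by
  obtain ⟨hσ0, -⟩ := hσ
  obtain ⟨-, hθ1⟩ := hθ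
  have hα : 0 < 1 - θ := by linarith
  set Z := Metric.ball (0 : EuclideanSpace ℝ (Fin d)) σ ∩ {y ∈ U | E y = 0}
  have h0Z : (0 : EuclideanSpace ℝ (Fin d)) ∈ Z := ⟨Metric.mem_ball_self hσ0, hU0, hE0⟩
  have hc : 0 < (1 - θ) * C / 2 := by positivity
  refine ⟨((1 - θ) * C / 2) ^ (1 / (2 * (1 - θ))), by positivity, σ / 4, ⟨by positivity, le_rfl⟩,
    fun x hx => ?_⟩
  have hR : Metric.infDist x Z < σ / 4 := (Metric.infDist_le_dist_of_mem h0Z).trans_lt hx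
  have hKσ : Metric.closedBall x (Metric.infDist x Z) ⊆ Metric.ball 0 σ := fun y hy => by
    have h1 := dist_triangle y x 0
    rw [Metric.mem_closedBall] at hy
    rw [Metric.mem_ball] at hx ⊢
    linarith
  have hkey : (1 - θ) * C / 2 * Metric.infDist x Z ≤ (E x ^ 2) ^ (1 - θ) := by
    refine mul_infDist_le_of_lt_norm_fderiv (G := fun y => (E y ^ 2) ^ (1 - θ))
      (G' := fun y => ((1 - θ) * (E y ^ 2) ^ (1 - θ - 1)) • fderiv ℝ (fun z => E z ^ 2) y) hc
      (((hE.continuousOn.mono (hKσ.trans hball)).pow 2).rpow_const fun _ _ => Or.inr hα.le)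
      (fun y _ => by positivity) fun y hy hyZ => ?_
    have hyσ := hKσ (Metric.ball_subset_closedBall hy)
    have hEy : E y ≠ 0 := fun h => hyZ ⟨hyσ, hball hyσ, h⟩
    have hpos : 0 < E y ^ 2 := by positivity
    have hdiff : DifferentiableAt ℝ (fun z => E z ^ 2) y :=
      ((hE.differentiableOn one_ne_zero).differentiableAt (hU.mem_nhds (hball hyσ))).pow 2
    refine ⟨hdiff.hasFDerivAt.rpow_const (Or.inl hpos.ne'), ?_⟩
    have hcoef : 0 < (1 - θ) * (E y ^ 2) ^ (1 - θ - 1) := by positivity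
    have hcancel : (E y ^ 2) ^ (1 - θ - 1) * (E y ^ 2) ^ θ = 1 := by
      rw [← Real.rpow_add hpos, show 1 - θ - 1 + θ = 0 by ring, Real.rpow_zero]
    rw [norm_smul, Real.norm_of_nonneg hcoef.le]
    calc (1 - θ) * C / 2 < (1 - θ) * C := half_lt_self (by positivity)
      _ = (1 - θ) * (E y ^ 2) ^ (1 - θ - 1) * (C * (E y ^ 2) ^ θ) := by
        linear_combination -((1 - θ) * C) * hcancel
      _ ≤ _ := mul_le_mul_of_nonneg_left (hLoj y hyσ) hcoef.le
  have habs : ((E x ^ 2) ^ (1 - θ)) ^ (1 / (2 * (1 - θ))) = |E x| := by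
    rw [← Real.rpow_mul (sq_nonneg _), show (1 - θ) * (1 / (2 * (1 - θ))) = 1 / 2 by field_simp,
      ← Real.sqrt_eq_rpow, Real.sqrt_sq_eq_abs]
  rw [ge_iff_le, ← Real.mul_rpow hc.le Metric.infDist_nonneg, ← habs]
  exact Real.rpow_le_rpow (mul_nonneg hc.le Metric.infDist_nonneg) hkey (by positivity)
end

section
/- Let d ≥ 1 be an integer, U ⊆ ℝ^d an open neighborhood of a point x∞, and E : U → ℝ a C¹ function with E'(x∞) = 0 and E ≥ 0 on U. Suppose E satisfies the Łojasiewicz gradient inequality near x∞ with constants C₀ ∈ (0,∞), σ ∈ (0,1], θ ∈ [1/2,1): B_σ(x∞) ⊆ U and ‖E'(x)‖ ≥ C₀·|E(x) − E(x∞)|^θ for all x ∈ B_σ(x∞), and that E(x∞) = 0. Then, with μ = θ/(1−θ) ∈ [1,∞), there exist constants C₂ ∈ (0,∞) and δ ∈ (0, σ/4] such that ‖E'(x)‖ ≥ C₂ · dist(x, B_σ(x∞) ∩ Crit E)^μ for all x ∈ B_δ(x∞). -/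
open Filter Topology in
/-- If the decrease of `F` near `y` is at most linear with slope `k`, then `k` bounds the norm
of the derivative of `F` at `y`. -/
theorem HasFDerivAt.norm_le_of_eventually_le_add {V : Type*} [NormedAddCommGroup V]
    [NormedSpace ℝ V] {F : V → ℝ} {F' : V →L[ℝ] ℝ} {y : V} {k : ℝ} (hk : 0 ≤ k)
    (hF : HasFDerivAt F F' y) (h : ∀ᶠ z in 𝓝 y, F y ≤ F z + k * ‖z - y‖) : ‖F'‖ ≤ k := by
  have key : ∀ v, -(k * ‖v‖) ≤ F' v := by
    intro v
    have h1 : HasDerivAt (fun t : ℝ => y + t • v) v 0 := by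
      simpa using ((hasDerivAt_id (0 : ℝ)).smul_const v).const_add y
    have h2 : HasDerivAt (fun t : ℝ => F (y + t • v)) (F' v) 0 := by
      have hF0 : HasFDerivAt F F' (y + (0 : ℝ) • v) := by simpa using hF
      exact hF0.comp_hasDerivAt 0 h1
    have h3 := h2.tendsto_slope_zero_right
    have h4 : Tendsto (fun t : ℝ => y + t • v) (𝓝[>] 0) (𝓝 y) := by
      have := h1.continuousAt.tendsto
      simp only [zero_smul, add_zero] at this
      exact this.mono_left nhdsWithin_le_nhds
    refine ge_of_tendsto h3 ?_
    filter_upwards [h4.eventually h, self_mem_nhdsWithin] with t ht (ht0 : 0 < t)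
    simp only [zero_add, zero_smul, add_zero, smul_eq_mul, add_sub_cancel_left, norm_smul,
      Real.norm_eq_abs, _root_.abs_of_pos ht0] at ht ⊢
    rw [inv_mul_eq_div, le_div_iff₀ ht0]
    linarith
  refine F'.opNorm_le_bound hk fun v => ?_
  have h1 := key v
  have h2 := key (-v)
  simp only [norm_neg, map_neg] at h2
  rw [Real.norm_eq_abs, abs_le]
  constructor <;> linarith

/-- A continuous non-negative function on a closed ball of radius `r` whose derivative dominates
`C * f ^ θ` inside the ball has a zero at distance at most `2 * f x ^ (1 - θ) / (C * (1 - θ))`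
from the centre `x`, provided this bound is smaller than `r`. -/
theorem exists_eq_zero_dist_le_of_norm_fderiv_ge {V : Type*} [NormedAddCommGroup V]
    [NormedSpace ℝ V] [ProperSpace V] {f : V → ℝ} {x : V} {r C θ : ℝ} (hr0 : 0 ≤ r) (hC : 0 < C)
    (hθ : θ < 1) (hcont : ContinuousOn f (Metric.closedBall x r))
    (hdiff : ∀ y ∈ Metric.ball x r, DifferentiableAt ℝ f y)
    (hnn : ∀ y ∈ Metric.closedBall x r, 0 ≤ f y)
    (hgrad : ∀ y ∈ Metric.ball x r, C * f y ^ θ ≤ ‖fderiv ℝ f y‖)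
    (hr : 2 * f x ^ (1 - θ) / (C * (1 - θ)) < r) :
    ∃ y ∈ Metric.ball x r, f y = 0 ∧ dist x y ≤ 2 * f x ^ (1 - θ) / (C * (1 - θ)) := by
  have hθ' : 0 < 1 - θ := by linarith
  set c := C * (1 - θ) with hc
  have hcpos : 0 < c := by positivity
  obtain ⟨y, hy, hmin⟩ := (isCompact_closedBall x r).exists_isMinOn
    (f := fun y => f y ^ (1 - θ) + c / 2 * ‖y - x‖) ⟨x, Metric.mem_closedBall_self hr0⟩
    ((hcont.rpow_const fun _ _ => Or.inr hθ'.le).add (by fun_prop))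
  have hyx : dist x y ≤ 2 * f x ^ (1 - θ) / c := by
    have h1 := hmin (Metric.mem_closedBall_self hr0)
    have h2 := Real.rpow_nonneg (hnn y hy) (1 - θ)
    simp only [Set.mem_ofPred_eq, sub_self, norm_zero, mul_zero, add_zero] at h1
    rw [dist_comm, dist_eq_norm, le_div_iff₀ hcpos]
    linarith
  have hyb : y ∈ Metric.ball x r := by
    rw [Metric.mem_ball, dist_comm]
    exact hyx.trans_lt hr
  refine ⟨y, hyb, ?_, hyx⟩
  by_contra hne
  have hpos : 0 < f y := lt_of_le_of_ne (hnn y hy) (Ne.symm hne)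
  have hder := (hdiff y hyb).hasFDerivAt.rpow_const (p := 1 - θ) (Or.inl hne)
  have hle := hder.norm_le_of_eventually_le_add (k := c / 2) (by positivity) (by
    filter_upwards [Metric.isOpen_ball.mem_nhds hyb] with z hz
    have h1 := hmin (Metric.ball_subset_closedBall hz)
    simp only [Set.mem_ofPred_eq] at h1
    have h2 : ‖z - x‖ ≤ ‖z - y‖ + ‖y - x‖ := norm_sub_le_norm_sub_add_norm_sub z y x
    nlinarith)
  have hcoef : 0 < (1 - θ) * f y ^ (1 - θ - 1) := by positivity
  rw [norm_smul, Real.norm_eq_abs, abs_of_pos hcoef] at hle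
  have h1 := mul_le_mul_of_nonneg_left (hgrad y hyb) hcoef.le
  have h2 : f y ^ (1 - θ - 1) * f y ^ θ = 1 := by
    rw [← Real.rpow_add hpos]
    norm_num
  have h3 : (1 - θ) * f y ^ (1 - θ - 1) * (C * f y ^ θ) = c := by
    rw [hc]
    linear_combination (C * (1 - θ)) * h2
  linarith


/-- **Łojasiewicz gradient–distance inequality for a non-negative function.** Let `E : U → ℝ`
be `C¹` on a neighborhood of `x∞` in `ℝ^d`, with `E'(x∞) = 0`, `E(x∞) = 0`, `E ≥ 0` on `U`,
satisfying the Łojasiewicz gradient inequality `‖E'(x)‖ ≥ C₀·|E(x) − E(x∞)|^θ` on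
`B_σ(x∞) ⊆ U` with `C₀ > 0`, `σ ∈ (0,1]`, `θ ∈ [1/2,1)`. Then with `μ = θ/(1−θ)` there are
`C₂ > 0` and `δ ∈ (0,σ/4]` with `‖E'(x)‖ ≥ C₂ · dist(x, B_σ(x∞) ∩ Crit E)^μ` on `B_δ(x∞)`. -/
theorem lojasiewicz_gradient_distance_inequality
    (d : ℕ) (hd : 1 ≤ d)
    (U : Set (EuclideanSpace ℝ (Fin d))) (hU : IsOpen U)
    (x_inf : EuclideanSpace ℝ (Fin d)) (hx : x_inf ∈ U)
    (E : EuclideanSpace ℝ (Fin d) → ℝ) (hE : ContDiffOn ℝ 1 E U)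
    (hcrit : fderiv ℝ E x_inf = 0) (hnn : ∀ x ∈ U, 0 ≤ E x) (hval : E x_inf = 0)
    (C₀ σ θ : ℝ) (hC₀ : 0 < C₀) (hσ : σ ∈ Set.Ioc (0:ℝ) 1) (hθ : θ ∈ Set.Ico (1/2 : ℝ) 1)
    (hball : Metric.ball x_inf σ ⊆ U)
    (hLoj : ∀ x ∈ Metric.ball x_inf σ, ‖fderiv ℝ E x‖ ≥ C₀ * |E x - E x_inf| ^ θ) :
    ∃ C₂ : ℝ, 0 < C₂ ∧ ∃ δ ∈ Set.Ioc (0:ℝ) (σ/4),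
      ∀ x ∈ Metric.ball x_inf δ,
        ‖fderiv ℝ E x‖ ≥ C₂ * (Metric.infDist x
          (Metric.ball x_inf σ ∩ {y ∈ U | fderiv ℝ E y = 0})) ^ (θ/(1-θ)) := by
  obtain ⟨hσ0, -⟩ := hσ
  obtain ⟨hθ0, hθ1⟩ := hθ
  have hθ' : 0 < 1 - θ := by linarith
  set K : ℝ := 2 / (C₀ * (1 - θ)) with hK
  have hKpos : 0 < K := by positivity
  have hcont : ContinuousOn E U := hE.continuousOn
  have hdiff : ∀ y ∈ U, DifferentiableAt ℝ E y := fun y hy =>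
    (hE.differentiableOn one_ne_zero).differentiableAt (hU.mem_nhds hy)
  have hsmall : ∀ᶠ x in nhds x_inf, K * E x ^ (1 - θ) < σ / 2 := by
    have h1 : ContinuousAt (fun x => K * E x ^ (1 - θ)) x_inf :=
      ((hcont.continuousAt (hU.mem_nhds hx)).rpow_const (Or.inr hθ'.le)).const_mul K
    refine h1.tendsto.eventually_lt_const ?_
    rw [hval, Real.zero_rpow hθ'.ne', mul_zero]
    positivity
  obtain ⟨ε, hε, hball_ε⟩ := Metric.eventually_nhds_iff_ball.1 hsmall
  refine ⟨C₀ / K ^ (θ / (1 - θ)), by positivity, min ε (σ / 4),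
    ⟨lt_min hε (by positivity), min_le_right _ _⟩, fun x hxδ => ?_⟩
  rw [Metric.mem_ball, lt_min_iff] at hxδ
  have hsub : Metric.closedBall x (σ / 2) ⊆ Metric.ball x_inf σ :=
    Metric.closedBall_subset_ball' (by linarith [hxδ.2])
  have hxσ : x ∈ Metric.ball x_inf σ := hsub (Metric.mem_closedBall_self (by positivity))
  have hgrad : ∀ y ∈ Metric.ball x_inf σ, C₀ * E y ^ θ ≤ ‖fderiv ℝ E y‖ := fun y hy => by
    simpa [hval, abs_of_nonneg (hnn y (hball hy))] using hLoj y hy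
  have hbound : 2 * E x ^ (1 - θ) / (C₀ * (1 - θ)) = K * E x ^ (1 - θ) := by
    rw [hK]
    ring
  obtain ⟨y, hy, hy0, hxy⟩ := exists_eq_zero_dist_le_of_norm_fderiv_ge (by positivity) hC₀ hθ1
    (hcont.mono (hsub.trans hball))
    (fun y hy => hdiff y (hball (hsub (Metric.ball_subset_closedBall hy))))
    (fun y hy => hnn y (hball (hsub hy)))
    (fun y hy => hgrad y (hsub (Metric.ball_subset_closedBall hy)))
    (hbound.trans_lt (hball_ε x hxδ.1))
  have hyσ := hsub (Metric.ball_subset_closedBall hy)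
  have hycrit : fderiv ℝ E y = 0 := by
    refine IsLocalMin.fderiv_eq_zero ?_
    filter_upwards [hU.mem_nhds (hball hyσ)] with z hz
    rw [hy0]
    exact hnn z hz
  have hdist := (Metric.infDist_le_dist_of_mem (x := x)
    (show y ∈ Metric.ball x_inf σ ∩ {y ∈ U | fderiv ℝ E y = 0} from
      ⟨hyσ, hball hyσ, hycrit⟩)).trans (hxy.trans_eq hbound)
  have hEx := hnn x (hball hxσ)
  have hpow := Real.rpow_le_rpow Metric.infDist_nonneg hdist
    (show 0 ≤ θ / (1 - θ) from div_nonneg (by linarith) hθ'.le)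
  rw [Real.mul_rpow hKpos.le (Real.rpow_nonneg hEx _), ← Real.rpow_mul hEx,
    mul_div_cancel₀ _ hθ'.ne'] at hpow
  have hKμ : 0 < K ^ (θ / (1 - θ)) := Real.rpow_pos_of_pos hKpos _
  refine le_trans ?_ (hgrad x hxσ)
  rw [div_mul_eq_mul_div, div_le_iff₀ hKμ]
  calc _ ≤ C₀ * (K ^ (θ / (1 - θ)) * E x ^ θ) := mul_le_mul_of_nonneg_left hpow hC₀.le
    _ = _ := by ring
end
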